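/- arXiv:2505.17865 — 5 statements merged into one kernel-verified Lean document; each statement's English description precedes it below -/
import Mathlib

section
/- Let Γ and Λ be infinite finitely generated virtually nilpotent groups (each contains a nilpotent subgroup of finite index), with fixed finite symmetric generating sets containing the identity, and suppose Γ has polynomial growth of degree m ≥ 1 and Λ has polynomial growth of degree n ≥ 1 with m ≤ n. Then there exists a single orbit equivalence coupling between Γ and Λ which is (L^q,L^q)-integrable for every 0 < q < m/n. -/
open MeasureTheory

universe u v

open scoped Pointwise in
/-- The word length of `g` with respect to a symmetric generating set `S` containing the
identity: the least `n` with `g ∈ S^n` (where `S^0 = {1}`). -/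
noncomputable def wordLength {G : Type*} [Group G] (S : Set G) (g : G) : ℕ :=
  sInf {n : ℕ | g ∈ S ^ n}

/-- `Γ` has polynomial growth of degree `r` with respect to the generating set `S`:
there is `C ≥ 1` with `C⁻¹·n^r ≤ #{γ : |γ|_S ≤ n} ≤ C·n^r` for all `n ≥ 1`. -/
def HasPolynomialGrowthDeg {Γ : Type*} [Group Γ] (S : Set Γ) (r : ℕ) : Prop :=
  ∃ C : ℝ, 1 ≤ C ∧ ∀ n : ℕ, 1 ≤ n →
    (n : ℝ) ^ r ≤ C * (Nat.card {γ : Γ // wordLength S γ ≤ n}) ∧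
    (Nat.card {γ : Γ // wordLength S γ ≤ n} : ℝ) ≤ C * (n : ℝ) ^ r

/-- An orbit equivalence coupling between countable groups `Γ` and `Λ`: measure-preserving,
essentially free Borel actions on standard Borel probability spaces together with a Borel
isomorphism `f` matching orbits almost everywhere, equipped with its associated measurable
cocycles `alpha`, `beta` satisfying `alpha(γ,x)·f(x) = f(γ·x)` and
`beta(λ,y)·f⁻¹(y) = f⁻¹(λ·y)` almost everywhere. -/
structure OrbitEquivalenceCoupling (Γ : Type u) (Λ : Type v) [Group Γ] [Group Λ] where
  (X : Type)
  (Y : Type)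
  [mX : MeasurableSpace X]
  [mY : MeasurableSpace Y]
  (sbX : StandardBorelSpace X)
  (sbY : StandardBorelSpace Y)
  (μ : Measure X)
  (ν : Measure Y)
  (probμ : IsProbabilityMeasure μ)
  (probν : IsProbabilityMeasure ν)
  (actG : Γ → X → X)
  (actH : Λ → Y → Y)
  (actG_one : ∀ x, actG 1 x = x)
  (actG_mul : ∀ (g g' : Γ) (x : X), actG (g * g') x = actG g (actG g' x))
  (actH_one : ∀ y, actH 1 y = y)
  (actH_mul : ∀ (h h' : Λ) (y : Y), actH (h * h') y = actH h (actH h' y))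
  (actG_meas : ∀ g : Γ, Measurable (actG g))
  (actH_meas : ∀ h : Λ, Measurable (actH h))
  (actG_pres : ∀ g : Γ, MeasurePreserving (actG g) μ μ)
  (actH_pres : ∀ h : Λ, MeasurePreserving (actH h) ν ν)
  (actG_free : ∀ᵐ x ∂μ, ∀ g : Γ, actG g x = x → g = 1)
  (actH_free : ∀ᵐ y ∂ν, ∀ h : Λ, actH h y = y → h = 1)
  (f : MeasurableEquiv X Y)
  (f_pres : MeasurePreserving f μ ν)
  (orbit_eq : ∀ᵐ x ∂μ,
    {y : Y | ∃ g : Γ, f (actG g x) = y} = {y : Y | ∃ h : Λ, actH h (f x) = y})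
  (alpha : Γ → X → Λ)
  (beta : Λ → Y → Γ)
  (alpha_meas : ∀ (g : Γ) (h : Λ), MeasurableSet {x : X | alpha g x = h})
  (beta_meas : ∀ (h : Λ) (g : Γ), MeasurableSet {y : Y | beta h y = g})
  (alpha_spec : ∀ g : Γ, ∀ᵐ x ∂μ, actH (alpha g x) (f x) = f (actG g x))
  (beta_spec : ∀ h : Λ, ∀ᵐ y ∂ν, actG (beta h y) (f.symm y) = f.symm (actH h y))

attribute [instance] OrbitEquivalenceCoupling.mX OrbitEquivalenceCoupling.mY

/-- An orbit equivalence between a group `G` and the integers: a probability measure preserving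
essentially free action of `G` on `Ω` together with a cocycle `pos` with values in `ℤ` which, on an
invariant conull set `good`, identifies each orbit with `ℤ`. -/
structure IntCoupling (G : Type u) [Group G] where
  Ω : Type
  [mΩ : MeasurableSpace Ω]
  [sb : StandardBorelSpace Ω]
  μ : Measure Ω
  [prob : IsProbabilityMeasure μ]
  act : G → Ω → Ω
  act_one : ∀ ω, act 1 ω = ω
  act_mul : ∀ g h ω, act (g * h) ω = act g (act h ω)
  act_pres : ∀ g, MeasurePreserving (act g) μ μ
  act_free : ∀ᵐ ω ∂μ, ∀ g, act g ω = ω → g = 1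
  good : Set Ω
  good_meas : MeasurableSet good
  good_ae : ∀ᵐ ω ∂μ, ω ∈ good
  good_act : ∀ g ω, ω ∈ good → act g ω ∈ good
  pos : G → Ω → ℤ
  pos_mul : ∀ g h ω, pos (g * h) ω = pos g (act h ω) + pos h ω
  pos_meas : ∀ g v, MeasurableSet {ω | pos g ω = v}
  pos_bij : ∀ ω ∈ good, Function.Bijective (fun g => pos g ω)

namespace IntCoupling

attribute [instance] IntCoupling.mΩ IntCoupling.sb IntCoupling.prob

section Basic

variable {G : Type u} [Group G] (c : IntCoupling G)

open Classical in
/-- The group element moving `ω` to the point at signed distance `v` in its orbit. -/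
noncomputable def elt (v : ℤ) (ω : c.Ω) : G :=
  if ω ∈ c.good then Function.invFun (fun g => c.pos g ω) v else 1

/-- The integer action with the same orbits as the action of `G`. -/
noncomputable def shift (v : ℤ) (ω : c.Ω) : c.Ω := c.act (c.elt v ω) ω

variable {c}

lemma act_inv_act (g : G) (ω : c.Ω) : c.act g⁻¹ (c.act g ω) = ω := by
  rw [← c.act_mul, inv_mul_cancel, c.act_one]

lemma act_mem_good_iff {g : G} {ω : c.Ω} : c.act g ω ∈ c.good ↔ ω ∈ c.good :=
  ⟨fun h => by simpa [act_inv_act] using c.good_act g⁻¹ _ h, c.good_act g ω⟩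

lemma pos_one (ω : c.Ω) : c.pos 1 ω = 0 := by
  have := c.pos_mul 1 1 ω
  simpa [c.act_one] using this

lemma pos_elt {ω : c.Ω} (h : ω ∈ c.good) (v : ℤ) : c.pos (c.elt v ω) ω = v := by
  rw [elt, if_pos h]
  exact Function.invFun_eq ((c.pos_bij ω h).2 v)

lemma elt_eq_iff {ω : c.Ω} (h : ω ∈ c.good) {v : ℤ} {g : G} :
    c.elt v ω = g ↔ c.pos g ω = v := by
  constructor
  · rintro rfl
    exact pos_elt h v
  · rintro rfl
    exact (c.pos_bij ω h).1 (pos_elt h _)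

lemma elt_of_notMem {ω : c.Ω} (h : ω ∉ c.good) (v : ℤ) : c.elt v ω = 1 := by
  rw [elt, if_neg h]

lemma shift_mem_good_iff {v : ℤ} {ω : c.Ω} : c.shift v ω ∈ c.good ↔ ω ∈ c.good :=
  act_mem_good_iff

lemma elt_add {ω : c.Ω} (v w : ℤ) :
    c.elt (v + w) ω = c.elt v (c.shift w ω) * c.elt w ω := by
  by_cases h : ω ∈ c.good
  · rw [elt_eq_iff h, c.pos_mul, pos_elt h]
    congr 1
    exact pos_elt (shift_mem_good_iff.2 h) v
  · rw [elt_of_notMem h, elt_of_notMem h, elt_of_notMem (mt shift_mem_good_iff.1 h), one_mul]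

lemma shift_add (v w : ℤ) (ω : c.Ω) : c.shift (v + w) ω = c.shift v (c.shift w ω) := by
  rw [shift, elt_add, c.act_mul]
  rfl

lemma elt_zero (ω : c.Ω) : c.elt 0 ω = 1 := by
  by_cases h : ω ∈ c.good
  · rw [elt_eq_iff h, pos_one]
  · exact elt_of_notMem h 0

lemma shift_zero (ω : c.Ω) : c.shift 0 ω = ω := by
  rw [shift, elt_zero, c.act_one]

lemma elt_neg (v : ℤ) (ω : c.Ω) : c.elt (-v) ω = (c.elt v (c.shift (-v) ω))⁻¹ := by
  have := elt_add v (-v) (ω := ω)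
  rw [add_neg_cancel, elt_zero] at this
  exact (inv_eq_of_mul_eq_one_right this.symm).symm

lemma elt_eq_iff_elt_neg {v : ℤ} {g : G} {ω : c.Ω} :
    c.elt v ω = g ↔ c.elt (-v) (c.act g ω) = g⁻¹ := by
  by_cases h : ω ∈ c.good
  · have h1 := c.pos_mul g⁻¹ g ω
    rw [inv_mul_cancel, pos_one] at h1
    rw [elt_eq_iff h, elt_eq_iff (c.good_act g ω h)]
    omega
  · rw [elt_of_notMem h, elt_of_notMem (mt act_mem_good_iff.1 h), eq_comm, @eq_comm _ 1, inv_eq_one]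

lemma elt_meas (v : ℤ) (g : G) : MeasurableSet {ω | c.elt v ω = g} := by
  have : {ω | c.elt v ω = g} = (c.good ∩ {ω | c.pos g ω = v}) ∪ (c.goodᶜ ∩ {_ω | g = 1}) := by
    ext ω
    by_cases h : ω ∈ c.good
    · simp [h, elt_eq_iff h]
    · simp [h, elt_of_notMem h, eq_comm]
  rw [this]
  exact (c.good_meas.inter (c.pos_meas g v)).union (c.good_meas.compl.inter (.const _))

lemma shift_preimage (v : ℤ) (E : Set c.Ω) :
    c.shift v ⁻¹' E = ⋃ g, c.act g ⁻¹' (E ∩ {ω | c.elt (-v) ω = g⁻¹}) := by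
  ext ω
  simp only [Set.mem_preimage, Set.mem_iUnion, Set.mem_inter_iff, Set.mem_ofPred_eq,
    ← elt_eq_iff_elt_neg]
  constructor
  · exact fun h => ⟨_, h, rfl⟩
  · rintro ⟨g, h, rfl⟩
    exact h

variable [Countable G]

lemma shift_meas (v : ℤ) : Measurable (c.shift v) := by
  intro E hE
  rw [shift_preimage]
  exact .iUnion fun g => (c.act_pres g).measurable (hE.inter (elt_meas _ _))

lemma shift_pres (v : ℤ) : MeasurePreserving (c.shift v) c.μ c.μ := by
  refine ⟨shift_meas v, ?_⟩
  ext E hE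
  rw [Measure.map_apply (shift_meas v) hE, shift_preimage, measure_iUnion]
  · have h1 : ∀ g : G, c.μ (c.act g ⁻¹' (E ∩ {ω | c.elt (-v) ω = g⁻¹})) =
        c.μ (E ∩ {ω | c.elt (-v) ω = g⁻¹}) := fun g =>
      (c.act_pres g).measure_preimage (hE.inter (elt_meas _ _)).nullMeasurableSet
    simp_rw [h1]
    rw [← measure_iUnion]
    · congr 1
      ext ω
      simp only [Set.mem_iUnion, Set.mem_inter_iff, Set.mem_ofPred_eq]
      exact ⟨fun ⟨g, h, _⟩ => h, fun h => ⟨(c.elt (-v) ω)⁻¹, h, by simp⟩⟩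
    · intro g h hgh
      rw [Function.onFun, Set.disjoint_left]
      rintro ω ⟨_, h1⟩ ⟨_, h2⟩
      exact hgh (inv_injective (h1.symm.trans h2))
    · exact fun g => hE.inter (elt_meas _ _)
  · intro g h hgh
    rw [Function.onFun, Set.disjoint_left]
    rintro ω ⟨_, h1⟩ ⟨_, h2⟩
    exact hgh ((elt_eq_iff_elt_neg.2 h1).symm.trans (elt_eq_iff_elt_neg.2 h2))
  · exact fun g => (c.act_pres g).measurable (hE.inter (elt_meas _ _))

end Basic

section Pair

variable {Γ : Type u} {Λ : Type v} [Group Γ] [Group Λ]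
  (c : IntCoupling Γ) (d : IntCoupling Λ)

/-- The action of `Γ` on the product of two integer couplings, through the integer action on the
second factor. -/
noncomputable def pairAct (g : Γ) (x : c.Ω × d.Ω) : c.Ω × d.Ω :=
  (c.act g x.1, d.shift (c.pos g x.1) x.2)

/-- The cocycle of `pairAct` with values in the second group. -/
noncomputable def pairCocycle (g : Γ) (x : c.Ω × d.Ω) : Λ := d.elt (c.pos g x.1) x.2

variable {c d}

lemma pairAct_one (x : c.Ω × d.Ω) : c.pairAct d 1 x = x := by
  simp [pairAct, c.act_one, pos_one, shift_zero]

lemma pairAct_mul (g h : Γ) (x : c.Ω × d.Ω) :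
    c.pairAct d (g * h) x = c.pairAct d g (c.pairAct d h x) := by
  simp [pairAct, c.act_mul, c.pos_mul, shift_add]

lemma pos_measurable (g : Γ) : Measurable (c.pos g) :=
  measurable_to_countable' (c.pos_meas g)

lemma pairAct_pres [Countable Λ] (g : Γ) :
    MeasurePreserving (c.pairAct d g) (c.μ.prod d.μ) (c.μ.prod d.μ) := by
  refine (c.act_pres g).skew_product (g := fun ω ω' => d.shift (c.pos g ω) ω') ?_ ?_
  · have : Measurable (fun p : ℤ × d.Ω => d.shift p.1 p.2) :=
      measurable_from_prod_countable_right fun v => shift_meas v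
    exact this.comp (((pos_measurable g).comp measurable_fst).prodMk measurable_snd)
  · exact ae_of_all _ fun ω => (shift_pres _).map_eq

lemma pairAct_free : ∀ᵐ x ∂(c.μ.prod d.μ), ∀ g : Γ, c.pairAct d g x = x → g = 1 := by
  filter_upwards [Measure.quasiMeasurePreserving_fst.ae c.act_free] with x hx g hg
  exact hx g (congrArg Prod.fst hg)

lemma pairCocycle_meas (g : Γ) (h : Λ) :
    MeasurableSet {x : c.Ω × d.Ω | c.pairCocycle d g x = h} := by
  have : {x : c.Ω × d.Ω | c.pairCocycle d g x = h} =
      ⋃ v : ℤ, {ω | c.pos g ω = v} ×ˢ {ω' | d.elt v ω' = h} := by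
    ext x
    simp [pairCocycle]
  rw [this]
  exact .iUnion fun v => (c.pos_meas g v).prod (elt_meas v h)

lemma swap_pairAct_pairCocycle {x : c.Ω × d.Ω} (h1 : x.1 ∈ c.good) (h2 : x.2 ∈ d.good) (g : Γ) :
    (d.pairAct c (c.pairCocycle d g x) x.swap).swap = c.pairAct d g x := by
  simp only [pairAct, pairCocycle, Prod.fst_swap, Prod.snd_swap, pos_elt h2, Prod.swap_prod_mk]
  rw [shift, (elt_eq_iff h1).2 rfl]
  rfl

variable (c d) in
/-- The orbit equivalence coupling obtained by composing two orbit equivalences with `ℤ`. -/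
noncomputable def toCoupling [Countable Γ] [Countable Λ] : OrbitEquivalenceCoupling Γ Λ where
  X := c.Ω × d.Ω
  Y := c.Ω × d.Ω
  sbX := inferInstance
  sbY := inferInstance
  μ := c.μ.prod d.μ
  ν := c.μ.prod d.μ
  probμ := inferInstance
  probν := inferInstance
  actG := c.pairAct d
  actH h x := (d.pairAct c h x.swap).swap
  actG_one := pairAct_one
  actG_mul := pairAct_mul
  actH_one x := by rw [pairAct_one, Prod.swap_swap]
  actH_mul h h' x := by rw [pairAct_mul, Prod.swap_swap]
  actG_meas g := (pairAct_pres g).measurable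
  actH_meas h := measurable_swap.comp ((pairAct_pres h).measurable.comp measurable_swap)
  actG_pres := pairAct_pres
  actH_pres h := Measure.measurePreserving_swap.comp
    ((pairAct_pres h).comp Measure.measurePreserving_swap)
  actG_free := pairAct_free
  actH_free := by
    filter_upwards [Measure.measurePreserving_swap.quasiMeasurePreserving.ae
      (pairAct_free (c := d) (d := c))] with x hx h hh
    exact hx h (by simpa using congrArg Prod.swap hh)
  f := MeasurableEquiv.refl _
  f_pres := MeasurePreserving.id _
  orbit_eq := by
    filter_upwards [Measure.quasiMeasurePreserving_fst.ae c.good_ae,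
      Measure.quasiMeasurePreserving_snd.ae d.good_ae] with x h1 h2
    ext y
    constructor
    · rintro ⟨g, rfl⟩
      exact ⟨c.pairCocycle d g x, swap_pairAct_pairCocycle h1 h2 g⟩
    · rintro ⟨h, rfl⟩
      exact ⟨d.pairCocycle c h x.swap,
        Prod.swap_injective (swap_pairAct_pairCocycle (c := d) (d := c) (x := x.swap) h2 h1 h)⟩
  alpha := c.pairCocycle d
  beta h x := d.pairCocycle c h x.swap
  alpha_meas := pairCocycle_meas
  beta_meas h g := measurable_swap (pairCocycle_meas (c := d) (d := c) h g)
  alpha_spec g := by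
    filter_upwards [Measure.quasiMeasurePreserving_fst.ae c.good_ae,
      Measure.quasiMeasurePreserving_snd.ae d.good_ae] with x h1 h2
    exact swap_pairAct_pairCocycle h1 h2 g
  beta_spec h := by
    filter_upwards [Measure.quasiMeasurePreserving_fst.ae c.good_ae,
      Measure.quasiMeasurePreserving_snd.ae d.good_ae] with x h1 h2
    exact Prod.swap_injective
      (swap_pairAct_pairCocycle (c := d) (d := c) (x := x.swap) h2 h1 h)

end Pair

end IntCoupling

section Tails

open scoped ENNReal

lemma lintegral_rpow_le_of_tail {Ω : Type*} [MeasurableSpace Ω] {μ : Measure Ω}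
    [IsProbabilityMeasure μ] {f : Ω → ℝ≥0∞} (hf : Measurable f) (hf_top : ∀ ω, f ω ≠ ∞)
    {p : ℝ} (hp : 0 < p) {a β A θ : ℝ≥0∞} (ha : a ≠ 0) (hβ : 1 < β)
    (h : ∀ k : ℕ, μ {ω | a * β ^ k < f ω} ≤ A * θ ^ k) :
    ∫⁻ ω, f ω ^ p ∂μ ≤ a ^ p + a ^ p * β ^ p * A * (1 - β ^ p * θ)⁻¹ := by
  have hpt : ∀ ω, f ω ^ p ≤ a ^ p + ∑' k : ℕ,
      {ω | a * β ^ k < f ω}.indicator (fun _ => (a * β ^ (k + 1)) ^ p) ω := by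
    intro ω
    by_cases h0 : f ω ≤ a
    · exact (ENNReal.rpow_le_rpow h0 hp.le).trans le_self_add
    · have hex : ∃ k : ℕ, f ω ≤ a * β ^ k := by
        have ht : Filter.Tendsto (fun k : ℕ => a * β ^ k) Filter.atTop (nhds ∞) := by
          have := ENNReal.Tendsto.const_mul (a := a)
            (ENNReal.tendsto_pow_atTop_nhds_top_iff.2 hβ) (Or.inl ENNReal.top_ne_zero)
          rwa [ENNReal.mul_top ha] at this
        obtain ⟨k, hk⟩ := (ht.eventually (lt_mem_nhds (lt_top_iff_ne_top.2 (hf_top ω)))).exists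
        exact ⟨k, hk.le⟩
      classical
      obtain ⟨k, hk⟩ : ∃ k, Nat.find hex = k + 1 := by
        refine Nat.exists_eq_succ_of_ne_zero fun h1 => h0 ?_
        simpa [h1] using Nat.find_spec hex
      have h1 : f ω ≤ a * β ^ (k + 1) := hk ▸ Nat.find_spec hex
      have h2 : a * β ^ k < f ω := not_le.1 (Nat.find_min hex (by omega))
      refine le_trans ?_ (le_add_self.trans (add_le_add_right (ENNReal.le_tsum k) _))
      rw [Set.indicator_of_mem (by exact h2)]
      exact ENNReal.rpow_le_rpow h1 hp.le
  have hmeas : ∀ k : ℕ, MeasurableSet {ω | a * β ^ k < f ω} := fun k =>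
    measurableSet_lt measurable_const hf
  calc ∫⁻ ω, f ω ^ p ∂μ ≤ ∫⁻ ω, (a ^ p + ∑' k : ℕ,
        {ω | a * β ^ k < f ω}.indicator (fun _ => (a * β ^ (k + 1)) ^ p) ω) ∂μ :=
        lintegral_mono hpt
    _ = a ^ p + ∑' k : ℕ, (a * β ^ (k + 1)) ^ p * μ {ω | a * β ^ k < f ω} := by
        rw [lintegral_add_left measurable_const, lintegral_const, measure_univ, mul_one,
          lintegral_tsum fun k => (measurable_const.indicator (hmeas k)).aemeasurable]
        simp_rw [lintegral_indicator_const (hmeas _)]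
    _ ≤ a ^ p + ∑' k : ℕ, (a ^ p * β ^ p * A) * (β ^ p * θ) ^ k := by
        refine add_le_add_right (ENNReal.tsum_le_tsum fun k => ?_) _
        refine (mul_le_mul_right (h k) _).trans (le_of_eq ?_)
        rw [ENNReal.mul_rpow_of_nonneg _ _ hp.le, pow_succ, ENNReal.mul_rpow_of_nonneg _ _ hp.le,
          ← ENNReal.rpow_natCast, ← ENNReal.rpow_mul, mul_comm (k : ℝ) p, ENNReal.rpow_mul,
          ENNReal.rpow_natCast, mul_pow]
        ring
    _ = _ := by rw [ENNReal.tsum_mul_left, ENNReal.tsum_geometric]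

lemma ENNReal.le_rpow_of_le_one_of_le {x y : ℝ≥0∞} {p : ℝ} (hp : 0 < p) (hp1 : p ≤ 1)
    (h1 : x ≤ 1) (h : x ≤ y) : x ≤ y ^ p := by
  rcases le_total y 1 with hy | hy
  · exact h.trans (by simpa using ENNReal.rpow_le_rpow_of_exponent_ge hy hp1)
  · exact h1.trans (ENNReal.one_le_rpow hy hp)

namespace IntCoupling

variable {Γ : Type u} {Λ : Type v} [Group Γ] [Group Λ]

/-- Tail estimates for the two cocycles of an integer coupling of a group of growth degree `d` with
length function `L`. -/
structure HasTails (c : IntCoupling Γ) (L : Γ → ℕ) (d : ℕ) : Prop where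
  pos_tail : ∃ C : ℝ≥0∞, 1 ≤ C ∧ C ≠ ∞ ∧ ∀ g, ∃ A : ℝ≥0∞, A ≠ ∞ ∧ ∀ k : ℕ,
    c.μ {ω | C * (2 ^ d) ^ k < ((c.pos g ω).natAbs : ℝ≥0∞)} ≤ A * 2⁻¹ ^ k
  elt_tail : ∃ C : ℝ≥0∞, 1 ≤ C ∧ C ≠ ∞ ∧ ∀ (v : ℤ) (k : ℕ),
    c.μ {ω | C * 2 ^ k < (L (c.elt v ω) : ℝ≥0∞)} ≤ C * v.natAbs * ((2 ^ d)⁻¹) ^ k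

variable {c : IntCoupling Γ} {d : IntCoupling Λ}

lemma HasTails.lintegral_pos_lt_top {L : Γ → ℕ} {m : ℕ} (h : c.HasTails L m) {p : ℝ}
    (hp : 0 < p) (hpm : m * p < 1) (hm : 1 ≤ m) (g : Γ) :
    ∫⁻ ω, ((c.pos g ω).natAbs : ℝ≥0∞) ^ p ∂c.μ < ∞ := by
  obtain ⟨C, hC1, hC, hCg⟩ := h.pos_tail
  obtain ⟨A, hA, hAk⟩ := hCg g
  have hmeas : Measurable fun ω => ((c.pos g ω).natAbs : ℝ≥0∞) :=
    (measurable_of_countable fun v : ℤ => ((v.natAbs : ℕ) : ℝ≥0∞)).comp (pos_measurable g)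
  refine (lintegral_rpow_le_of_tail hmeas (fun ω => ENNReal.natCast_ne_top _) hp
    (one_pos.trans_le hC1).ne' ?_ hAk).trans_lt ?_
  · exact one_lt_pow₀ (by norm_num) (by omega)
  · have h2 : ((2 : ℝ≥0∞) ^ m) ^ p * 2⁻¹ < 1 := by
      rw [← ENNReal.rpow_natCast, ← ENNReal.rpow_mul, ← ENNReal.rpow_neg_one,
        ← ENNReal.rpow_add _ _ (by norm_num) (by norm_num)]
      exact ENNReal.rpow_lt_one_of_one_lt_of_neg (by norm_num) (by linarith)
    have hCp : C ^ p < ∞ := ENNReal.rpow_lt_top_of_nonneg hp.le hC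
    have hβ : ((2 : ℝ≥0∞) ^ m) ^ p < ∞ :=
      ENNReal.rpow_lt_top_of_nonneg hp.le (ENNReal.pow_ne_top (by norm_num))
    refine ENNReal.add_lt_top.2 ⟨hCp, ENNReal.mul_lt_top (ENNReal.mul_lt_top
      (ENNReal.mul_lt_top hCp hβ) (lt_top_iff_ne_top.2 hA)) ?_⟩
    exact ENNReal.inv_lt_top.2 (tsub_pos_of_lt h2)

lemma measurable_comp_of_fibers {α β γ : Type*} [MeasurableSpace α] [MeasurableSpace γ]
    [Countable β] {f : α → β} (hf : ∀ b, MeasurableSet {a | f a = b}) (F : β → γ) :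
    Measurable fun a => F (f a) := by
  let _ : MeasurableSpace β := ⊤
  exact (measurable_from_top (f := F)).comp (measurable_to_countable' hf)

lemma HasTails.lintegral_elt_le [Countable Λ] {L : Λ → ℕ} {n : ℕ} (h : d.HasTails L n) {p q : ℝ}
    (hp : 0 < p) (hp1 : p ≤ 1) (hq : 0 < q) (hqp : q < n * p) :
    ∃ a b : ℝ≥0∞, a ≠ ∞ ∧ b ≠ ∞ ∧ ∀ v : ℤ,
      ∫⁻ ω, (L (d.elt v ω) : ℝ≥0∞) ^ q ∂d.μ ≤ a + b * (v.natAbs : ℝ≥0∞) ^ p := by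
  obtain ⟨C, hC1, hC, hCv⟩ := h.elt_tail
  have hCq : C ^ q ≠ ∞ := ENNReal.rpow_ne_top_of_nonneg hq.le hC
  have hCp : C ^ p ≠ ∞ := ENNReal.rpow_ne_top_of_nonneg hp.le hC
  have h2q : (2 : ℝ≥0∞) ^ q ≠ ∞ := ENNReal.rpow_ne_top_of_nonneg hq.le (by norm_num)
  refine ⟨C ^ q, C ^ q * 2 ^ q * C ^ p * (1 - 2 ^ q * ((2 ^ n)⁻¹) ^ p)⁻¹, hCq, ?_, fun v => ?_⟩
  · have h2 : (2 : ℝ≥0∞) ^ q * ((2 ^ n)⁻¹) ^ p < 1 := by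
      rw [← ENNReal.rpow_natCast, ← ENNReal.rpow_neg, ← ENNReal.rpow_mul,
        ← ENNReal.rpow_add _ _ (by norm_num) (by norm_num)]
      exact ENNReal.rpow_lt_one_of_one_lt_of_neg (by norm_num) (by linarith)
    exact ENNReal.mul_ne_top (ENNReal.mul_ne_top (ENNReal.mul_ne_top hCq h2q) hCp)
      (ENNReal.inv_lt_top.2 (tsub_pos_of_lt h2)).ne
  · refine (lintegral_rpow_le_of_tail (a := C) (β := 2) (A := (C * v.natAbs) ^ p)
      (θ := ((2 ^ n)⁻¹) ^ p)
      (measurable_comp_of_fibers (elt_meas v) fun g => (L g : ℝ≥0∞))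
      (fun ω => ENNReal.natCast_ne_top _) hq
      (one_pos.trans_le hC1).ne' (by norm_num) fun k => ?_).trans (le_of_eq ?_)
    · have hcomm : (((2 ^ n)⁻¹ : ℝ≥0∞) ^ p) ^ k = (((2 ^ n)⁻¹) ^ k) ^ p := by
        rw [← ENNReal.rpow_natCast, ← ENNReal.rpow_mul, mul_comm p, ENNReal.rpow_mul,
          ENNReal.rpow_natCast]
      rw [hcomm, ← ENNReal.mul_rpow_of_nonneg _ _ hp.le]
      exact ENNReal.le_rpow_of_le_one_of_le hp hp1 prob_le_one (hCv v k)
    · rw [ENNReal.mul_rpow_of_nonneg _ _ hp.le]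
      ring

lemma HasTails.lintegral_pairCocycle_lt_top [Countable Λ] {L : Γ → ℕ} {L' : Λ → ℕ} {m n : ℕ}
    (h : c.HasTails L m) (h' : d.HasTails L' n) (hm : 1 ≤ m) (hn : 1 ≤ n) {q : ℝ} (hq : 0 < q)
    (hqmn : q * m < n) (g : Γ) :
    ∫⁻ x, (L' (c.pairCocycle d g x) : ℝ≥0∞) ^ q ∂(c.μ.prod d.μ) < ∞ := by
  have hm' : (1 : ℝ) ≤ m := by exact_mod_cast hm
  have hn' : (1 : ℝ) ≤ n := by exact_mod_cast hn
  obtain ⟨p, hp1, hp2⟩ : ∃ p : ℝ, q / n < p ∧ p < 1 / m :=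
    exists_between (by rw [div_lt_div_iff₀ (by linarith) (by linarith)]; linarith)
  have hp : 0 < p := lt_of_le_of_lt (by positivity) hp1
  rw [div_lt_iff₀ (by linarith)] at hp1
  rw [lt_div_iff₀ (by linarith)] at hp2
  have hple : p ≤ 1 := by nlinarith
  obtain ⟨a, b, ha, hb, hab⟩ := h'.lintegral_elt_le hp hple hq (by linarith)
  rw [lintegral_prod _ (measurable_comp_of_fibers (pairCocycle_meas g)
    fun h => (L' h : ℝ≥0∞) ^ q).aemeasurable]
  refine (lintegral_mono fun ω => hab (c.pos g ω)).trans_lt ?_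
  have hmeas : Measurable fun ω => ((c.pos g ω).natAbs : ℝ≥0∞) ^ p :=
    (measurable_of_countable fun v : ℤ => ((v.natAbs : ℕ) : ℝ≥0∞) ^ p).comp (pos_measurable g)
  rw [lintegral_add_left measurable_const, lintegral_const, measure_univ, mul_one,
    lintegral_const_mul _ hmeas]
  exact ENNReal.add_lt_top.2 ⟨ha.lt_top, ENNReal.mul_lt_top hb.lt_top
    (h.lintegral_pos_lt_top hp (by linarith) hm g)⟩

lemma integrable_rpow_of_lintegral {α : Type*} [MeasurableSpace α] {μ : Measure α} {f : α → ℕ}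
    (hf : Measurable f) {q : ℝ} (hq : 0 < q) (h : ∫⁻ x, (f x : ℝ≥0∞) ^ q ∂μ < ∞) :
    Integrable (fun x => (f x : ℝ) ^ q) μ := by
  refine ⟨((measurable_of_countable fun k : ℕ => (k : ℝ) ^ q).comp hf).aestronglyMeasurable, ?_⟩
  rw [hasFiniteIntegral_iff_enorm]
  refine lt_of_eq_of_lt (lintegral_congr fun x => ?_) h
  rw [Real.enorm_eq_ofReal (by positivity), ← ENNReal.ofReal_rpow_of_nonneg (by positivity) hq.le,
    ENNReal.ofReal_natCast]

/-- Two integer couplings satisfying the tail estimates compose to an integrable coupling. -/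
lemma HasTails.exists_coupling [Countable Γ] [Countable Λ] {L : Γ → ℕ} {L' : Λ → ℕ} {m n : ℕ}
    (h : c.HasTails L m) (h' : d.HasTails L' n) (hm : 1 ≤ m) (hmn : m ≤ n) :
    ∃ e : OrbitEquivalenceCoupling Γ Λ, ∀ q : ℝ, 0 < q → q < (m : ℝ) / (n : ℝ) →
      (∀ g : Γ, Integrable (fun x => (L' (e.alpha g x) : ℝ) ^ q) e.μ) ∧
      (∀ g : Λ, Integrable (fun y => (L (e.beta g y) : ℝ) ^ q) e.ν) := by
  refine ⟨c.toCoupling d, fun q hq hqmn => ⟨fun g => ?_, fun g => ?_⟩⟩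
  all_goals
    have hm' : (1 : ℝ) ≤ m := by exact_mod_cast hm
    have hmn' : (m : ℝ) ≤ n := by exact_mod_cast hmn
    rw [lt_div_iff₀ (by linarith)] at hqmn
  · refine integrable_rpow_of_lintegral (measurable_comp_of_fibers (pairCocycle_meas g) L') hq
      (h.lintegral_pairCocycle_lt_top h' hm (hm.trans hmn) hq ?_ g)
    nlinarith
  · have key : Integrable (fun y => (L (d.pairCocycle c g y) : ℝ) ^ q) (d.μ.prod c.μ) :=
      integrable_rpow_of_lintegral (measurable_comp_of_fibers (pairCocycle_meas g) L) hq
        (h'.lintegral_pairCocycle_lt_top h (hm.trans hmn) hm hq hqmn g)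
    exact key.swap

end IntCoupling

end Tails

section Order

variable {G : Type*}

/-- Two points agree from level `k` on. -/
def Agree (ℓ : ℕ → G → ℝ) (k : ℕ) (x y : G) : Prop := ∀ j, k ≤ j → ℓ j x = ℓ j y

/-- The antilexicographic order associated with a sequence of labels. -/
def Below (ℓ : ℕ → G → ℝ) (x y : G) : Prop := ∃ j, ℓ j x < ℓ j y ∧ Agree ℓ (j + 1) x y

/-- The signed number of points between `x` and `y` in the antilexicographic order. -/
noncomputable def orderGap (ℓ : ℕ → G → ℝ) (x y : G) : ℤ :=
  {z | ¬ Below ℓ z x ∧ Below ℓ z y}.ncard - {z | ¬ Below ℓ z y ∧ Below ℓ z x}.ncard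

/-- Sequences of labels for which the antilexicographic order is isomorphic to `ℤ`. -/
structure IsLabelling (ℓ : ℕ → G → ℝ) : Prop where
  inj : Function.Injective (ℓ 0)
  agree : ∀ x y, ∃ k, Agree ℓ k x y
  finite : ∀ k x, {y | Agree ℓ k x y}.Finite
  exists_above : ∀ x, ∃ y, Below ℓ x y
  exists_below : ∀ x, ∃ y, Below ℓ y x

variable {ℓ : ℕ → G → ℝ} {k j : ℕ} {x y z : G}

lemma Agree.rfl : Agree ℓ k x x := fun _ _ => Eq.refl _

lemma Agree.symm (h : Agree ℓ k x y) : Agree ℓ k y x := fun j hj => (h j hj).symm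

lemma Agree.trans (h : Agree ℓ k x y) (h' : Agree ℓ k y z) : Agree ℓ k x z :=
  fun j hj => (h j hj).trans (h' j hj)

lemma Agree.mono (h : Agree ℓ k x y) (hkj : k ≤ j) : Agree ℓ j x y :=
  fun i hi => h i (hkj.trans hi)

lemma not_below_self : ¬ Below ℓ x x := fun ⟨_, h, _⟩ => lt_irrefl _ h

lemma Below.trans (h : Below ℓ x y) (h' : Below ℓ y z) : Below ℓ x z := by
  obtain ⟨j, hj, hj'⟩ := h
  obtain ⟨i, hi, hi'⟩ := h'
  rcases lt_trichotomy j i with h | rfl | h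
  · exact ⟨i, (hj' i h).trans_lt hi, (hj'.mono (by omega)).trans hi'⟩
  · exact ⟨j, hj.trans hi, hj'.trans hi'⟩
  · exact ⟨j, hj.trans_eq (hi' j h), hj'.trans (hi'.mono (by omega))⟩

lemma Agree.below_trichotomy (hinj : Function.Injective (ℓ 0)) (h : Agree ℓ k x y) :
    Below ℓ x y ∨ x = y ∨ Below ℓ y x := by
  induction k with
  | zero => exact Or.inr (Or.inl (hinj (h 0 le_rfl)))
  | succ k ih =>
    rcases lt_trichotomy (ℓ k x) (ℓ k y) with hk | hk | hk
    · exact Or.inl ⟨k, hk, h⟩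
    · refine ih fun j hj => ?_
      rcases hj.eq_or_lt with rfl | hj
      · exact hk
      · exact h j hj
    · exact Or.inr (Or.inr ⟨k, hk, h.symm⟩)

lemma Agree.of_below_of_below (h : Agree ℓ k x y) (hxz : Below ℓ x z) (hzy : Below ℓ z y) :
    Agree ℓ k x z := by
  obtain ⟨j, hj, hj'⟩ := hxz
  obtain ⟨i, hi, hi'⟩ := hzy
  rcases lt_or_ge j k with hjk | hjk
  · exact hj'.mono hjk
  rcases lt_or_ge i k with hik | hik
  · exact h.trans (hi'.mono hik).symm
  rcases lt_trichotomy j i with hji | rfl | hji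
  · exact absurd (h i hik) ((hj' i hji).trans_lt hi).ne
  · exact absurd (h j hjk) (hj.trans hi).ne
  · exact absurd (h j hjk) (hj.trans_eq (hi' j hji)).ne

lemma IsLabelling.exists_equiv [Nonempty G] (h : IsLabelling ℓ) :
    ∃ e : G ≃ ℤ, ∀ x y, Below ℓ x y ↔ e x < e y := by
  classical
  have : IsStrictTotalOrder G (Below ℓ) :=
    { irrefl := fun _ => not_below_self
      trans := fun _ _ _ => Below.trans
      trichotomous := fun x y hxy hyx => by
        obtain ⟨k, hk⟩ := h.agree x y
        rcases hk.below_trichotomy h.inj with h1 | h1 | h1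
        exacts [absurd h1 hxy, h1, absurd h1 hyx] }
  let _ : LinearOrder G := linearOrderOfSTO (Below ℓ)
  have hlt : ∀ x y : G, Below ℓ x y ↔ x < y := fun _ _ => Iff.rfl
  have : NoMaxOrder G := ⟨h.exists_above⟩
  have : NoMinOrder G := ⟨h.exists_below⟩
  let _ : LocallyFiniteOrder G := LocallyFiniteOrder.ofFiniteIcc fun x y => by
    obtain ⟨k, hk⟩ := h.agree x y
    refine (h.finite k x).subset fun z hz => ?_
    rcases hz.1.eq_or_lt with rfl | h1
    · exact Agree.rfl
    rcases hz.2.eq_or_lt with rfl | h2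
    · exact hk
    exact hk.of_below_of_below h1 h2
  let _ : SuccOrder G := LinearLocallyFiniteOrder.succOrder G
  let _ : PredOrder G := LinearLocallyFiniteOrder.predOrder G
  let e : G ≃o ℤ := orderIsoIntOfLinearSuccPredArch
  exact ⟨e.toEquiv, fun x y => (e.lt_iff_lt (x := x) (y := y)).symm⟩

lemma ncard_eq_toNat {e : G ≃ ℤ} (he : ∀ x y, Below ℓ x y ↔ e x < e y) (x y : G) :
    {z | ¬ Below ℓ z x ∧ Below ℓ z y}.ncard = (e y - e x).toNat := by
  have : {z | ¬ Below ℓ z x ∧ Below ℓ z y} = e ⁻¹' (Finset.Ico (e x) (e y) : Finset ℤ) := by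
    ext z
    simp [he]
  rw [this, Set.ncard_preimage_of_injective_subset_range e.injective (by simp [e.surjective.range_eq]),
    Set.ncard_coe_finset, Int.card_Ico]

lemma orderGap_eq_sub {e : G ≃ ℤ} (he : ∀ x y, Below ℓ x y ↔ e x < e y) (x y : G) :
    orderGap ℓ x y = e y - e x := by
  rw [orderGap, ncard_eq_toNat he, ncard_eq_toNat he]
  omega

lemma IsLabelling.orderGap_add (h : IsLabelling ℓ) (x y z : G) :
    orderGap ℓ x z = orderGap ℓ x y + orderGap ℓ y z := by
  have : Nonempty G := ⟨x⟩
  obtain ⟨e, he⟩ := h.exists_equiv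
  simp only [orderGap_eq_sub he]
  ring

lemma IsLabelling.orderGap_bijective (h : IsLabelling ℓ) (x : G) :
    Function.Bijective (orderGap ℓ x) := by
  have : Nonempty G := ⟨x⟩
  obtain ⟨e, he⟩ := h.exists_equiv
  have : orderGap ℓ x = fun y => Equiv.addRight (-e x) (e y) := by
    ext y
    rw [orderGap_eq_sub he]
    simp [sub_eq_add_neg]
  rw [this]
  exact (Equiv.bijective _).comp e.bijective

lemma IsLabelling.natAbs_orderGap_le (h : IsLabelling ℓ) (hxy : Agree ℓ k x y) :
    (orderGap ℓ x y).natAbs ≤ {z | Agree ℓ k x z}.ncard := by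
  have : Nonempty G := ⟨x⟩
  obtain ⟨e, he⟩ := h.exists_equiv
  have hle : ∀ x y : G, Agree ℓ k x y →
      (e y - e x).toNat ≤ {z | Agree ℓ k x z}.ncard := by
    intro x y hxy
    rw [← ncard_eq_toNat he]
    refine Set.ncard_le_ncard (fun z hz => ?_) (h.finite k x)
    rcases eq_or_ne x z with rfl | hne
    · exact Agree.rfl
    · refine hxy.of_below_of_below ?_ hz.2
      have := hz.1
      rw [he] at this ⊢
      exact lt_of_le_of_ne (not_lt.1 this) (e.injective.ne hne)
  have h1 := hle x y hxy
  have h2 := hle y x hxy.symm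
  have h3 : {z | Agree ℓ k y z} = {z | Agree ℓ k x z} :=
    Set.ext fun z => ⟨hxy.trans, hxy.symm.trans⟩
  rw [h3] at h2
  rw [orderGap_eq_sub he]
  omega

lemma IsLabelling.exists_isMax (h : IsLabelling ℓ) {x y : G} {v : ℕ} (hv : orderGap ℓ x y = v)
    (hxy : ¬ Agree ℓ k x y) :
    ∃ i < v, ∃ z, orderGap ℓ x z = i ∧ ∀ w, Agree ℓ k z w → ¬ Below ℓ z w := by
  have : Nonempty G := ⟨x⟩
  obtain ⟨e, he⟩ := h.exists_equiv
  obtain ⟨z, hz, hmax⟩ := Set.exists_max_image {z | Agree ℓ k x z} e (h.finite k x) ⟨x, Agree.rfl⟩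
  have hxz : e x ≤ e z := hmax x Agree.rfl
  rw [orderGap_eq_sub he] at hv
  have hzy : e z < e y := by
    by_contra! hcon
    refine hxy ?_
    rcases eq_or_ne x y with rfl | hne
    · exact Agree.rfl
    rcases eq_or_ne y z with rfl | hne'
    · exact hz
    have h1 := e.injective.ne hne
    have h2 := e.injective.ne hne'
    exact Agree.of_below_of_below hz ((he _ _).2 (by omega)) ((he _ _).2 (by omega))
  refine ⟨(e z - e x).toNat, by omega, z, ?_, fun w hw hzw => ?_⟩
  · rw [orderGap_eq_sub he]
    omega
  · have := hmax w (Agree.trans hz hw)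
    rw [he] at hzw
    omega

section Measurability

variable {Ω : Type*} [MeasurableSpace Ω]

variable {ℓ : Ω → ℕ → G → ℝ}

lemma measurableSet_agree (hℓ : ∀ j x, Measurable fun ω => ℓ ω j x) (k : ℕ) (x y : G) :
    MeasurableSet {ω | Agree (ℓ ω) k x y} := by
  have : {ω | Agree (ℓ ω) k x y} = ⋂ j, ⋂ (_ : k ≤ j), {ω | ℓ ω j x = ℓ ω j y} := by
    ext ω
    simp [Agree]
  rw [this]
  exact .iInter fun j => .iInter fun _ => measurableSet_eq_fun (hℓ j x) (hℓ j y)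

lemma measurableSet_below (hℓ : ∀ j x, Measurable fun ω => ℓ ω j x) (x y : G) :
    MeasurableSet {ω | Below (ℓ ω) x y} := by
  have : {ω | Below (ℓ ω) x y} =
      ⋃ j, {ω | ℓ ω j x < ℓ ω j y} ∩ {ω | Agree (ℓ ω) (j + 1) x y} := by
    ext ω
    simp [Below]
  rw [this]
  exact .iUnion fun j => (measurableSet_lt (hℓ j x) (hℓ j y)).inter (measurableSet_agree hℓ _ x y)

lemma measurable_orderGap [Countable G] (hℓ : ∀ j x, Measurable fun ω => ℓ ω j x) (x y : G) :
    Measurable fun ω => orderGap (ℓ ω) x y := by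
  have : ∀ x y : G, Measurable fun ω => {z | ¬ Below (ℓ ω) z x ∧ Below (ℓ ω) z y}.ncard :=
    fun x y => measurable_ncard.comp <| measurable_set_iff.2 fun z => measurableSet_setOfPred.1 <|
      (measurableSet_below hℓ z x).compl.inter (measurableSet_below hℓ z y)
  exact ((measurable_of_countable fun p : ℕ × ℕ => (p.1 : ℤ) - p.2).comp
    ((this x y).prodMk (this y x)))

end Measurability

end Order

section Row

open scoped ENNReal

/-- The law of a family of independent uniform labels on `G`. -/
noncomputable def rowLaw (G : Type) : Measure (G → ℝ) :=
  Measure.infinitePi fun _ => ProbabilityTheory.gaussianReal 0 1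

instance : IsProbabilityMeasure (rowLaw G) := by
  rw [rowLaw]
  infer_instance

variable {G : Type}

lemma measurePreserving_comp_rowLaw (σ : Equiv.Perm G) :
    MeasurePreserving (fun η : G → ℝ => η ∘ σ) (rowLaw G) (rowLaw G) :=
  ⟨by fun_prop, Measure.map_infinitePi_infinitePi_of_inj
    (P := fun _ : G => ProbabilityTheory.gaussianReal 0 1) σ.injective⟩

lemma rowLaw_ae_injective [Countable G] : ∀ᵐ η ∂rowLaw G, Function.Injective η := by
  have hne : ∀ x y : G, x ≠ y → ∀ᵐ η ∂rowLaw G, η x ≠ η y := by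
    intro x y hxy
    have hatoms : NullSingletonClass (ProbabilityTheory.gaussianReal 0 1) :=
      ProbabilityTheory.nullSingletonClass_gaussianReal one_ne_zero
    have hdiag : ∀ᵐ p ∂(ProbabilityTheory.gaussianReal 0 1).prod
        (ProbabilityTheory.gaussianReal 0 1), p.1 ≠ p.2 := by
      refine (Measure.ae_prod_iff_ae_ae (p := fun p : ℝ × ℝ => p.1 ≠ p.2)
        (measurableSet_eq_fun measurable_fst measurable_snd).compl).2 ?_
      exact ae_of_all _ fun a => by simp [ae_iff]
    rw [← Measure.infinitePi_map_eval_prod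
      (P := fun _ : G => ProbabilityTheory.gaussianReal 0 1) hxy] at hdiag
    exact ae_of_ae_map (f := fun η : G → ℝ => (η x, η y)) (by fun_prop) hdiag
  have : ∀ᵐ η ∂rowLaw G, ∀ x y : G, x ≠ y → η x ≠ η y := by
    rw [ae_all_iff]
    intro x
    rw [ae_all_iff]
    intro y
    by_cases hxy : x = y
    · simp [hxy]
    · filter_upwards [hne x y hxy] with η hη _ using hη
  filter_upwards [this] with η hη x y hxy
  by_contra hcon
  exact hη x y hcon hxy

lemma measurableSet_isLeast (F : Finset G) (z : G) :
    MeasurableSet {η : G → ℝ | ∀ w ∈ F, η z ≤ η w} := by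
  have : {η : G → ℝ | ∀ w ∈ F, η z ≤ η w} = ⋂ w ∈ F, {η | η z ≤ η w} := by
    ext η
    simp
  rw [this]
  exact .biInter F.countable_toSet fun w _ =>
    measurableSet_le (measurable_pi_apply z) (measurable_pi_apply w)

lemma card_mul_rowLaw_isLeast_le [Countable G] [DecidableEq G] (F : Finset G) {z : G} (hz : z ∈ F) :
    F.card * rowLaw G {η | ∀ w ∈ F, η z ≤ η w} ≤ 1 := by
  have hswap : ∀ y ∈ F, rowLaw G {η | ∀ w ∈ F, η y ≤ η w} =
      rowLaw G {η | ∀ w ∈ F, η z ≤ η w} := by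
    intro y hy
    rw [← (measurePreserving_comp_rowLaw (Equiv.swap y z)).measure_preimage
      (measurableSet_isLeast F y).nullMeasurableSet]
    congr 1
    ext η
    simp only [Set.mem_preimage, Set.mem_ofPred_eq, Function.comp_apply, Equiv.swap_apply_left]
    have hmem : ∀ w ∈ F, Equiv.swap y z w ∈ F := by
      intro w hw
      rw [Equiv.swap_apply_def]
      split_ifs <;> assumption
    exact ⟨fun h w hw => by simpa using h _ (hmem w hw), fun h w hw => h _ (hmem w hw)⟩
  calc (F.card : ℝ≥0∞) * rowLaw G {η | ∀ w ∈ F, η z ≤ η w}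
      = ∑ y ∈ F, rowLaw G {η | ∀ w ∈ F, η y ≤ η w} := by
        rw [Finset.sum_congr rfl hswap, Finset.sum_const, nsmul_eq_mul]
    _ = rowLaw G (⋃ y ∈ F, {η | ∀ w ∈ F, η y ≤ η w}) := by
        rw [measure_biUnion_finset₀ _ fun y _ => (measurableSet_isLeast F y).nullMeasurableSet]
        intro y hy y' hy' hne
        refine measure_mono_null (fun η hη => ?_) (ae_iff.1 (rowLaw_ae_injective (G := G)))
        exact fun hinj => hne (hinj (le_antisymm (hη.1 y' hy') (hη.2 y hy)))
    _ ≤ 1 := prob_le_one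

open Classical in
/-- The points of `B` with a label not exceeding those of `F`. -/
noncomputable def lowPoints (F B : Finset G) (η : G → ℝ) : Finset G :=
  {z ∈ B | ∀ w ∈ F, η z ≤ η w}

lemma measurable_card_lowPoints (F B : Finset G) :
    Measurable fun η => ((lowPoints F B η).card : ℝ≥0∞) := by
  have : (fun η => ((lowPoints F B η).card : ℝ≥0∞)) =
      fun η => ∑ z ∈ B, {η : G → ℝ | ∀ w ∈ F, η z ≤ η w}.indicator 1 η := by
    ext η
    classical
    simp [lowPoints, Set.indicator_apply]
  rw [this]
  exact Finset.measurable_sum _ fun z _ => measurable_one.indicator (measurableSet_isLeast F z)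

lemma lintegral_card_lowPoints_le [Countable G] (F B : Finset G) :
    ∫⁻ η, (lowPoints F B η).card ∂rowLaw G ≤ B.card / F.card := by
  classical
  have : ∀ η, ((lowPoints F B η).card : ℝ≥0∞) =
      ∑ z ∈ B, {η : G → ℝ | ∀ w ∈ F, η z ≤ η w}.indicator 1 η := by
    intro η
    simp [lowPoints, Set.indicator_apply]
  simp_rw [this]
  rw [lintegral_finsetSum _ fun z _ => measurable_one.indicator (measurableSet_isLeast F z)]
  simp_rw [lintegral_indicator_one (measurableSet_isLeast F _)]
  rw [div_eq_mul_inv, ← nsmul_eq_mul]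
  refine Finset.sum_le_card_nsmul _ _ _ fun z _ => ?_
  have h1 := card_mul_rowLaw_isLeast_le (insert z F) (Finset.mem_insert_self z F)
  simp only [Finset.mem_insert, forall_eq_or_imp, le_refl, true_and] at h1
  rw [ENNReal.le_inv_iff_mul_le, mul_comm]
  refine le_trans ?_ h1
  gcongr
  exact Finset.subset_insert z F

end Row

/-- Proper length functions on a group generated by the elements of length at most one. -/
structure IsLength {G : Type*} [Group G] (L : G → ℕ) : Prop where
  one : L 1 = 0
  mul_le : ∀ g h, L (g * h) ≤ L g + L h
  inv : ∀ g, L g⁻¹ = L g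
  eq_one : ∀ g, L g = 0 → g = 1
  gen : Subgroup.closure {g | L g ≤ 1} = ⊤
  finite : ∀ r, {g | L g ≤ r}.Finite

namespace IsLength

open scoped ENNReal

section RowMin

variable {G : Type} [Group G] {L : G → ℕ} (h : IsLength L)

/-- The ball of radius `r`. -/
noncomputable def ball (r : ℕ) : Finset G := (h.finite r).toFinset

lemma mem_ball {r : ℕ} {g : G} : g ∈ h.ball r ↔ L g ≤ r := by simp [ball]

lemma one_mem_ball (r : ℕ) : 1 ∈ h.ball r := by simp [mem_ball, h.one]

lemma ball_nonempty (r : ℕ) : (h.ball r).Nonempty := ⟨1, h.one_mem_ball r⟩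

lemma ball_mono {r s : ℕ} (hrs : r ≤ s) : h.ball r ⊆ h.ball s := fun _ hg =>
  h.mem_ball.2 ((h.mem_ball.1 hg).trans hrs)

lemma ball_zero : h.ball 0 = {1} := by
  ext g
  simp only [mem_ball, Nat.le_zero, Finset.mem_singleton]
  exact ⟨h.eq_one g, fun hg => hg ▸ h.one⟩

/-- The least label in the ball of radius `r` around a point. -/
noncomputable def rowMin (r : ℕ) (η : G → ℝ) (x : G) : ℝ :=
  (h.ball r).inf' (h.ball_nonempty r) fun z => η (x * z)

lemma rowMin_zero (η : G → ℝ) : h.rowMin 0 η = η := by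
  ext x
  simp [rowMin, ball_zero]

lemma rowMin_translate (r : ℕ) (η : G → ℝ) (g x : G) :
    h.rowMin r (fun y => η (g⁻¹ * y)) x = h.rowMin r η (g⁻¹ * x) := by
  simp only [rowMin, mul_assoc]

lemma rowMin_le {r : ℕ} (η : G → ℝ) (x : G) {z : G} (hz : L (x⁻¹ * z) ≤ r) :
    h.rowMin r η x ≤ η z := by
  exact (Finset.inf'_le (fun z => η (x * z)) (h.mem_ball.2 hz)).trans_eq (by simp)

lemma exists_rowMin_eq (r : ℕ) (η : G → ℝ) (x : G) :
    ∃ z, L (x⁻¹ * z) ≤ r ∧ h.rowMin r η x = η z := by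
  obtain ⟨z, hz, hzx⟩ := Finset.exists_mem_eq_inf' (h.ball_nonempty r) fun z => η (x * z)
  exact ⟨x * z, by simpa using h.mem_ball.1 hz, hzx⟩

lemma le_of_rowMin_eq {r : ℕ} {η : G → ℝ} (hη : Function.Injective η) {x y : G}
    (hxy : h.rowMin r η x = h.rowMin r η y) : L (x⁻¹ * y) ≤ 2 * r := by
  obtain ⟨z, hz, hzx⟩ := h.exists_rowMin_eq r η x
  obtain ⟨w, hw, hwy⟩ := h.exists_rowMin_eq r η y
  obtain rfl : z = w := hη (by rw [← hzx, ← hwy, hxy])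
  have h1 := h.mul_le (x⁻¹ * z) (y⁻¹ * z)⁻¹
  rw [h.inv] at h1
  have h2 : x⁻¹ * z * (y⁻¹ * z)⁻¹ = x⁻¹ * y := by group
  rw [h2] at h1
  omega

lemma measurable_rowMin (r : ℕ) (x : G) : Measurable fun η => h.rowMin r η x := by
  have : Measurable ((h.ball r).inf' (h.ball_nonempty r) fun z (η : G → ℝ) => η (x * z)) :=
    Finset.inf'_induction _ _ (fun _ hf _ hg => hf.inf hg) fun z _ => measurable_pi_apply (x * z)
  convert this using 1
  ext η
  simp [rowMin]

lemma image_rowMin_subset [DecidableEq ℝ] {r t : ℕ} (htr : t ≤ r) (η : G → ℝ) :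
    (h.ball t).image (h.rowMin r η) ⊆
      (lowPoints (h.ball (r - t)) (h.ball (r + t)) η).image η := by
  intro a ha
  obtain ⟨x, hx, rfl⟩ := Finset.mem_image.1 ha
  obtain ⟨z, hz, hzx⟩ := h.exists_rowMin_eq r η x
  rw [mem_ball] at hx
  refine Finset.mem_image.2 ⟨z, ?_, hzx.symm⟩
  simp only [lowPoints, Finset.mem_filter, mem_ball]
  refine ⟨?_, fun w hw => hzx ▸ h.rowMin_le η x ?_⟩
  · have := h.mul_le x (x⁻¹ * z)
    rw [mul_inv_cancel_left] at this
    omega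
  · have := h.mul_le x⁻¹ w
    rw [h.inv] at this
    omega

end RowMin

end IsLength

section Field

open scoped ENNReal

/-- The law of a sequence of independent families of independent labels on `G`. -/
noncomputable def fieldLaw (G : Type) : Measure (ℕ → G → ℝ) := Measure.infinitePi fun _ => rowLaw G

instance (G : Type) : IsProbabilityMeasure (fieldLaw G) := by
  rw [fieldLaw]
  infer_instance

/-- The translation action of a group on label sequences. -/
def fieldAct {G : Type} [Group G] (g : G) (ω : ℕ → G → ℝ) : ℕ → G → ℝ :=
  fun j x => ω j (g⁻¹ * x)

variable {G : Type} [Group G]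

lemma fieldAct_one (ω : ℕ → G → ℝ) : fieldAct 1 ω = ω := by
  funext j x
  simp [fieldAct]

lemma fieldAct_mul (g g' : G) (ω : ℕ → G → ℝ) :
    fieldAct (g * g') ω = fieldAct g (fieldAct g' ω) := by
  funext j x
  simp [fieldAct, mul_assoc]

lemma fieldAct_pres (g : G) : MeasurePreserving (fieldAct g) (fieldLaw G) (fieldLaw G) := by
  refine ⟨measurable_pi_lambda _ fun j => measurable_pi_lambda _ fun x => by
    unfold fieldAct; fun_prop, ?_⟩
  have h1 := measurePreserving_comp_rowLaw (Equiv.mulLeft g⁻¹)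
  have h2 := Measure.infinitePi_map_pi (fun _ : ℕ => rowLaw G) (fun _ : ℕ => h1.measurable)
  simp only [h1.map_eq] at h2
  exact h2

omit [Group G] in
lemma fieldLaw_ae_injective [Countable G] :
    ∀ᵐ ω ∂fieldLaw G, ∀ j, Function.Injective (ω j) := by
  rw [ae_all_iff]
  intro j
  exact (measurePreserving_eval_infinitePi (fun _ : ℕ => rowLaw G) j).quasiMeasurePreserving.ae
    rowLaw_ae_injective

omit [Group G] in
lemma lintegral_prod_lowPoints_le [Countable G] (F B : ℕ → Finset G) (s : Finset ℕ) :
    ∫⁻ ω, ∏ j ∈ s, ((lowPoints (F j) (B j) (ω j)).card : ℝ≥0∞) ∂fieldLaw G ≤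
      ∏ j ∈ s, (((B j).card : ℝ≥0∞) / (F j).card) := by
  have hind := ProbabilityTheory.iIndepFun_infinitePi (P := fun _ : ℕ => rowLaw G)
    (X := fun j η => ((lowPoints (F j) (B j) η).card : ℝ≥0∞))
    (fun j => measurable_card_lowPoints (F j) (B j))
  have hmeas : ∀ j, Measurable fun ω : ℕ → G → ℝ =>
      ((lowPoints (F j) (B j) (ω j)).card : ℝ≥0∞) := fun j =>
    (measurable_card_lowPoints (F j) (B j)).comp (measurable_pi_apply j)
  rw [fieldLaw, ProbabilityTheory.lintegral_prod_eq_prod_lintegral_of_indepFun s _ hind hmeas]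
  refine Finset.prod_le_prod' fun j _ => ?_
  have := (measurePreserving_eval_infinitePi (fun _ : ℕ => rowLaw G) j).lintegral_comp
    (measurable_card_lowPoints (F j) (B j))
  exact this.trans_le (lintegral_card_lowPoints_le (F j) (B j))

end Field

namespace IsLength

open scoped ENNReal

variable {G : Type} [Group G] {L : G → ℕ} (h : IsLength L) (r : ℕ → ℕ)

/-- The labels of a point: at level `j`, the least label at distance at most `r j`. -/
noncomputable def label (ω : ℕ → G → ℝ) (j : ℕ) (x : G) : ℝ := h.rowMin (r j) (ω j) x

lemma measurable_label (j : ℕ) (x : G) : Measurable fun ω => h.label r ω j x :=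
  (h.measurable_rowMin (r j) x).comp (measurable_pi_apply j)

lemma label_fieldAct (g : G) (ω : ℕ → G → ℝ) (j : ℕ) (x : G) :
    h.label r (fieldAct g ω) j x = h.label r ω j (g⁻¹ * x) := h.rowMin_translate _ _ _ _

lemma agree_fieldAct (g : G) (ω : ℕ → G → ℝ) (k : ℕ) (x y : G) :
    Agree (h.label r (fieldAct g ω)) k x y ↔ Agree (h.label r ω) k (g⁻¹ * x) (g⁻¹ * y) := by
  simp only [Agree, label_fieldAct]

lemma below_fieldAct (g : G) (ω : ℕ → G → ℝ) (x y : G) :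
    Below (h.label r (fieldAct g ω)) x y ↔ Below (h.label r ω) (g⁻¹ * x) (g⁻¹ * y) := by
  simp only [Below, agree_fieldAct, label_fieldAct]

lemma orderGap_fieldAct (g : G) (ω : ℕ → G → ℝ) (x y : G) :
    orderGap (h.label r (fieldAct g ω)) x y = orderGap (h.label r ω) (g⁻¹ * x) (g⁻¹ * y) := by
  have : ∀ x y : G, {z | ¬ Below (h.label r (fieldAct g ω)) z x ∧
      Below (h.label r (fieldAct g ω)) z y}.ncard =
      {z | ¬ Below (h.label r ω) z (g⁻¹ * x) ∧ Below (h.label r ω) z (g⁻¹ * y)}.ncard := by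
    intro x y
    simp only [below_fieldAct]
    exact Set.ncard_preimage_of_injective_subset_range
      (s := {z | ¬ Below (h.label r ω) z (g⁻¹ * x) ∧ Below (h.label r ω) z (g⁻¹ * y)})
      (mul_right_injective g⁻¹)
      (by simp [(Group.mulLeft_bijective g⁻¹).2.range_eq])
  rw [orderGap, orderGap, this, this]

lemma measure_eq_measure_one {p : (ℕ → G → ℝ) → G → Prop} (hp : ∀ x, MeasurableSet {ω | p ω x})
    (hact : ∀ g ω x, p (fieldAct g ω) x ↔ p ω (g⁻¹ * x)) (x : G) :
    fieldLaw G {ω | p ω x} = fieldLaw G {ω | p ω 1} := by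
  rw [← (fieldAct_pres x).measure_preimage (hp x).nullMeasurableSet]
  simp [Set.preimage, hact]

variable {r}

lemma card_le_prod_lowPoints {ω : ℕ → G → ℝ} {k K t : ℕ} (ht : ∀ j, k ≤ j → t ≤ r j)
    {S : Finset G} (hS : S ⊆ h.ball t)
    (hsep : ∀ x ∈ S, ∀ y ∈ S, (∀ j ∈ Finset.Ico k K, h.label r ω j x = h.label r ω j y) → x = y) :
    S.card ≤ ∏ j ∈ Finset.Ico k K,
      (lowPoints (h.ball (r j - t)) (h.ball (r j + t)) (ω j)).card := by
  classical
  calc S.card ≤ ((Finset.Ico k K).pi fun j => (h.ball t).image (h.label r ω j)).card := by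
        refine Finset.card_le_card_of_injOn (fun x j _ => h.label r ω j x) (fun x hx => ?_)
          fun x hx y hy hxy => ?_
        · rw [Finset.mem_coe, Finset.mem_pi]
          exact fun j _ => Finset.mem_image_of_mem _ (hS hx)
        · exact hsep x hx y hy fun j hj => congrFun (congrFun hxy j) hj
    _ = ∏ j ∈ Finset.Ico k K, ((h.ball t).image (h.label r ω j)).card := Finset.card_pi _ _
    _ ≤ _ := Finset.prod_le_prod' fun j hj =>
        (Finset.card_le_card (h.image_rowMin_subset (ht j (Finset.mem_Ico.1 hj).1) (ω j))).trans
          Finset.card_image_le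

lemma card_le_iSup_prod_lowPoints {ω : ℕ → G → ℝ} {k t : ℕ} (ht : ∀ j, k ≤ j → t ≤ r j)
    {S : Finset G} (hS : S ⊆ h.ball t)
    (hsep : ∀ x ∈ S, ∀ y ∈ S, Agree (h.label r ω) k x y → x = y) :
    (S.card : ℝ≥0∞) ≤ ⨆ K, ∏ j ∈ Finset.Ico k K,
      ((lowPoints (h.ball (r j - t)) (h.ball (r j + t)) (ω j)).card : ℝ≥0∞) := by
  have hex : ∀ x y : G, ∃ K, x ∈ S → y ∈ S →
      (∀ j ∈ Finset.Ico k K, h.label r ω j x = h.label r ω j y) → x = y := by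
    intro x y
    by_cases hxy : Agree (h.label r ω) k x y
    · exact ⟨0, fun hx hy _ => hsep x hx y hy hxy⟩
    · simp only [Agree, not_forall] at hxy
      obtain ⟨j, hj, hne⟩ := hxy
      exact ⟨j + 1, fun _ _ hcon => absurd (hcon j (by simp [hj])) hne⟩
  choose K hK using hex
  let K' := (S ×ˢ S).sup fun p => K p.1 p.2
  refine le_trans ?_ (le_iSup _ K')
  have := h.card_le_prod_lowPoints ht hS (K := K') (ω := ω) fun x hx y hy hcon =>
    hK x y hx hy fun j hj => hcon j (Finset.Ico_subset_Ico le_rfl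
      (Finset.le_sup (f := fun p : G × G => K p.1 p.2) (b := (x, y)) (by simp [hx, hy])) hj)
  exact_mod_cast this

/-- The probability that the identity is the selected point of its class, when at most one point is
selected in each class. -/
lemma card_ball_mul_measure_le [Countable G] {p : (ℕ → G → ℝ) → G → Prop}
    (hp : ∀ x, MeasurableSet {ω | p ω x})
    (hact : ∀ g ω x, p (fieldAct g ω) x ↔ p ω (g⁻¹ * x)) {k t : ℕ}
    (hsep : ∀ᵐ ω ∂fieldLaw G, ∀ x y, p ω x → p ω y → Agree (h.label r ω) k x y → x = y)
    (ht : ∀ j, k ≤ j → t ≤ r j) {D : ℝ≥0∞}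
    (hD : ∀ K, ∏ j ∈ Finset.Ico k K,
      (((h.ball (r j + t)).card : ℝ≥0∞) / (h.ball (r j - t)).card) ≤ D) :
    (h.ball t).card * fieldLaw G {ω | p ω 1} ≤ D := by
  classical
  have hpos : ∀ j, k ≤ j → ∀ ω : ℕ → G → ℝ,
      (1 : ℝ≥0∞) ≤ (lowPoints (h.ball (r j - t)) (h.ball (r j + t)) (ω j)).card := by
    intro j hj ω
    have h1 := Finset.card_le_card (h.image_rowMin_subset (ht j hj) (ω j))
    have h2 := ((h.ball_nonempty t).image (h.rowMin (r j) (ω j))).card_pos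
    exact_mod_cast (Nat.succ_le_of_lt h2).trans (h1.trans Finset.card_image_le)
  calc (h.ball t).card * fieldLaw G {ω | p ω 1}
      = ∑ x ∈ h.ball t, fieldLaw G {ω | p ω x} := by
        rw [Finset.sum_congr rfl fun x _ => measure_eq_measure_one hp hact x, Finset.sum_const,
          nsmul_eq_mul]
    _ = ∫⁻ ω, ∑ x ∈ h.ball t, {ω | p ω x}.indicator 1 ω ∂fieldLaw G := by
        rw [lintegral_finsetSum _ fun x _ => measurable_one.indicator (hp x)]
        simp_rw [lintegral_indicator_one (hp _)]
    _ ≤ ∫⁻ ω, ⨆ K, ∏ j ∈ Finset.Ico k K,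
        ((lowPoints (h.ball (r j - t)) (h.ball (r j + t)) (ω j)).card : ℝ≥0∞) ∂fieldLaw G := by
        refine lintegral_mono_ae ?_
        filter_upwards [hsep] with ω hω
        have : ∑ x ∈ h.ball t, {ω | p ω x}.indicator (1 : (ℕ → G → ℝ) → ℝ≥0∞) ω =
            ({x ∈ h.ball t | p ω x} : Finset G).card := by
          simp [Set.indicator_apply]
        rw [this]
        refine h.card_le_iSup_prod_lowPoints ht (Finset.filter_subset _ _) fun x hx y hy => ?_
        exact hω x y (Finset.mem_filter.1 hx).2 (Finset.mem_filter.1 hy).2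
    _ = ⨆ K, ∫⁻ ω, ∏ j ∈ Finset.Ico k K,
        ((lowPoints (h.ball (r j - t)) (h.ball (r j + t)) (ω j)).card : ℝ≥0∞) ∂fieldLaw G := by
        refine lintegral_iSup (fun K => ?_) (monotone_nat_of_le_succ fun K ω => ?_)
        · exact Finset.measurable_prod _ fun j _ =>
            (measurable_card_lowPoints _ _).comp (measurable_pi_apply j)
        · rcases lt_or_ge K k with hK | hK
          · simp [Finset.Ico_eq_empty_of_le hK.le, Finset.Ico_eq_empty_of_le (Nat.succ_le_of_lt hK)]
          · simp only [Finset.prod_Ico_succ_top hK]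
            exact le_mul_of_one_le_right' (hpos K hK ω)
    _ ≤ D := iSup_le fun K => (lintegral_prod_lowPoints_le _ _ _).trans (hD K)

lemma one_add_measure_label_ne_le [Countable G] {j : ℕ} (hj : 1 ≤ r j) {g : G} (hg : L g ≤ 1) :
    1 + fieldLaw G {ω | h.label r ω j 1 ≠ h.label r ω j g} ≤
      ((h.ball (r j + 1)).card : ℝ≥0∞) / (h.ball (r j - 1)).card := by
  classical
  have hmeas : MeasurableSet {ω | h.label r ω j 1 ≠ h.label r ω j g} :=
    (measurableSet_eq_fun (h.measurable_label r j 1) (h.measurable_label r j g)).compl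
  calc 1 + fieldLaw G {ω | h.label r ω j 1 ≠ h.label r ω j g}
      = ∫⁻ ω, (1 + {ω | h.label r ω j 1 ≠ h.label r ω j g}.indicator 1 ω) ∂fieldLaw G := by
        rw [lintegral_add_left measurable_const, lintegral_indicator_one hmeas]
        simp
    _ ≤ ∫⁻ ω, ∏ i ∈ {j}, ((lowPoints (h.ball (r i - 1)) (h.ball (r i + 1)) (ω i)).card : ℝ≥0∞)
        ∂fieldLaw G := by
        refine lintegral_mono fun ω => ?_
        rw [Finset.prod_singleton]
        have h1 := (Finset.card_le_card (h.image_rowMin_subset hj (ω j))).trans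
          Finset.card_image_le
        have h2 : ({h.label r ω j 1, h.label r ω j g} : Finset ℝ).card ≤
            ((h.ball 1).image (h.rowMin (r j) (ω j))).card := by
          refine Finset.card_le_card ?_
          simp only [Finset.insert_subset_iff, Finset.singleton_subset_iff]
          exact ⟨Finset.mem_image_of_mem _ (h.one_mem_ball 1),
            Finset.mem_image_of_mem _ (h.mem_ball.2 hg)⟩
        have h3 := h2.trans h1
        by_cases hne : h.label r ω j 1 = h.label r ω j g
        · rw [Set.indicator_of_notMem (by simpa using hne), add_zero]
          exact Nat.one_le_cast.2 ((Finset.card_pos.2 (Finset.insert_nonempty _ _)).trans_le h3)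
        · rw [Finset.card_pair hne] at h3
          rw [Set.indicator_of_mem (by simpa using hne), Pi.one_apply, one_add_one_eq_two]
          exact Nat.cast_le (α := ℝ≥0∞).2 h3
    _ ≤ _ := (lintegral_prod_lowPoints_le _ _ _).trans_eq (Finset.prod_singleton _ _)

end IsLength

section Radii

open Finset

lemma sum_sub_le_of_monotone {b : ℕ → ℝ} (hb : Monotone b) (hb0 : ∀ n, 0 ≤ b n) {R t : ℕ}
    (ht : t ≤ R) :
    ∑ r ∈ Ico R (2 * R), (b (r + t) - b (r - t)) ≤ 2 * t * b (2 * R + t) := by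
  have h1 : ∑ r ∈ Ico R (2 * R), b (r + t) = ∑ x ∈ Ico (R + t) (2 * R + t), b x :=
    sum_Ico_add' b R (2 * R) t
  have h2 : ∑ r ∈ Ico R (2 * R), b (r - t) = ∑ x ∈ Ico (R - t) (2 * R - t), b x := by
    have := sum_Ico_add' (fun r => b (r - t)) (R - t) (2 * R - t) t
    simp only [Nat.add_sub_cancel] at this
    rw [this]
    congr 2 <;> omega
  have h3 := sum_Ico_consecutive b (m := R - t) (n := 2 * R - t) (k := 2 * R + t)
    (by omega) (by omega)
  have h4 := sum_Ico_consecutive b (m := R - t) (n := R + t) (k := 2 * R + t)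
    (by omega) (by omega)
  have h5 : ∑ x ∈ Ico (2 * R - t) (2 * R + t), b x ≤ 2 * t * b (2 * R + t) := by
    have := sum_le_card_nsmul (Ico (2 * R - t) (2 * R + t)) b (b (2 * R + t)) fun x hx =>
      hb (mem_Ico.1 hx).2.le
    rw [Nat.card_Ico, nsmul_eq_mul, show 2 * R + t - (2 * R - t) = 2 * t by omega] at this
    exact_mod_cast this
  have h6 : 0 ≤ ∑ x ∈ Ico (R - t) (R + t), b x := sum_nonneg fun x _ => hb0 x
  rw [sum_sub_distrib, h1, h2]
  linarith

lemma sum_range_pow_sub_le {q : ℝ} (hq : 0 ≤ q) (hq1 : q < 1) (j : ℕ) :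
    ∑ i ∈ range j, q ^ (j - i) ≤ q / (1 - q) := by
  induction j with
  | zero => simpa using div_nonneg hq (by linarith)
  | succ j ih =>
    have : ∑ i ∈ range j, q ^ (j + 1 - i) = q * ∑ i ∈ range j, q ^ (j - i) := by
      rw [mul_sum]
      refine sum_congr rfl fun i hi => ?_
      rw [Nat.sub_add_comm (mem_range.1 hi).le, pow_succ']
    rw [sum_range_succ, this, Nat.add_sub_cancel_left, pow_one]
    calc q * ∑ i ∈ range j, q ^ (j - i) + q ≤ q * (q / (1 - q)) + q := by gcongr
      _ = q / (1 - q) := by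
        have : 1 - q ≠ 0 := by linarith
        field_simp
        ring

lemma exists_radius {b : ℕ → ℝ} (hb : Monotone b) (hb0 : ∀ n, 0 ≤ b n) {j : ℕ} {M : ℝ}
    (hM : 0 ≤ M) (hbM : b (2 ^ (j + 2)) ≤ M * b (2 ^ (j - 1))) (hj : 1 ≤ j) :
    ∃ r, 2 ^ j ≤ r ∧ r < 2 ^ (j + 1) ∧
      b (r + 1) ≤ (1 + 6 * M * (1 / 2) ^ j) * b (r - 1) ∧
      ∀ i < j, b (r + 2 ^ i) ≤ (1 + 6 * M * (3 / 4) ^ (j - i)) * b (r - 2 ^ i) := by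
  set B := b (2 ^ (j - 1)) with hB
  have hB0 : 0 ≤ B := hb0 _
  set f : ℕ → ℕ → ℝ := fun t r => b (r + t) - b (r - t) with hf
  have hf0 : ∀ t r, 0 ≤ f t r := fun t r => sub_nonneg.2 (hb (by omega))
  have h2j : 2 ^ j = 2 * 2 ^ (j - 1) := by rw [← pow_succ']; congr 1; omega
  have hsum : ∀ i < j, ∑ r ∈ Ico (2 ^ j) (2 * 2 ^ j), f (2 ^ i) r ≤ 2 * 2 ^ i * (M * B) := by
    intro i hi
    have hij : 2 ^ i ≤ 2 ^ (j - 1) := Nat.pow_le_pow_right (by norm_num) (by omega)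
    refine (sum_sub_le_of_monotone hb hb0 (by omega)).trans ?_
    push_cast
    gcongr
    refine (hb ?_).trans hbM
    rw [pow_add]
    omega
  obtain ⟨r, hr, hW⟩ : ∃ r ∈ Ico (2 ^ j) (2 * 2 ^ j), 2 ^ j * f (2 ^ 0) r +
      ∑ i ∈ range j, (4 / 3 : ℝ) ^ (j - i) * f (2 ^ i) r ≤ 6 * (M * B) := by
    refine exists_le_of_sum_le ⟨2 ^ j, by simp⟩ ?_
    rw [sum_add_distrib, ← mul_sum, sum_comm]
    simp_rw [← mul_sum]
    have h1 : ∑ i ∈ range j, (4 / 3 : ℝ) ^ (j - i) * ∑ r ∈ Ico (2 ^ j) (2 * 2 ^ j), f (2 ^ i) r ≤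
        2 ^ j * (4 * (M * B)) := by
      calc ∑ i ∈ range j, (4 / 3 : ℝ) ^ (j - i) * ∑ r ∈ Ico (2 ^ j) (2 * 2 ^ j), f (2 ^ i) r
          ≤ ∑ i ∈ range j, 2 ^ j * (2 * (M * B)) * (2 / 3 : ℝ) ^ (j - i) := by
            refine sum_le_sum fun i hi => ?_
            have hi' := mem_range.1 hi
            refine (mul_le_mul_of_nonneg_left (hsum i hi') (by positivity)).trans_eq ?_
            have h43 : (4 / 3 : ℝ) ^ (j - i) = 2 ^ (j - i) * (2 / 3) ^ (j - i) := by
              rw [← mul_pow]; norm_num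
            have h2 : (2 : ℝ) ^ j = 2 ^ (j - i) * 2 ^ i := by
              rw [← pow_add]; congr 1; omega
            rw [h43, h2]
            ring
        _ ≤ 2 ^ j * (2 * (M * B)) * ((2 / 3) / (1 - 2 / 3)) := by
            rw [← mul_sum]
            gcongr
            exact sum_range_pow_sub_le (by norm_num) (by norm_num) j
        _ = _ := by ring
    have h2 := mul_le_mul_of_nonneg_left (hsum 0 (by omega)) (by positivity : (0 : ℝ) ≤ 2 ^ j)
    rw [sum_const, Nat.card_Ico, nsmul_eq_mul, show 2 * 2 ^ j - 2 ^ j = 2 ^ j by omega]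
    push_cast at h2 ⊢
    nlinarith
  rw [mem_Ico] at hr
  have hBr : ∀ i < j, B ≤ b (r - 2 ^ i) := by
    intro i hi
    have hij : 2 ^ i ≤ 2 ^ (j - 1) := Nat.pow_le_pow_right (by norm_num) (by omega)
    exact hb (by omega)
  have hfin : ∀ i < j, ∀ c ε : ℝ, 0 ≤ ε → ε * c = 1 → c * f (2 ^ i) r ≤ 6 * (M * B) →
      b (r + 2 ^ i) ≤ (1 + 6 * M * ε) * b (r - 2 ^ i) := by
    intro i hi c ε hε hc hle
    have h1 := mul_le_mul_of_nonneg_left hle hε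
    rw [← mul_assoc, hc, one_mul] at h1
    have h2 : ε * (6 * (M * B)) ≤ ε * (6 * (M * b (r - 2 ^ i))) := by
      gcongr
      exact hBr i hi
    simp only [hf] at h1
    linarith
  have hnn : ∀ i ∈ range j, 0 ≤ (4 / 3 : ℝ) ^ (j - i) * f (2 ^ i) r := fun i _ =>
    mul_nonneg (by positivity) (hf0 _ _)
  refine ⟨r, hr.1, by rw [pow_succ']; exact hr.2, ?_, fun i hi => ?_⟩
  · refine hfin 0 (by omega) (2 ^ j) ((1 / 2) ^ j) (by positivity) (by rw [← mul_pow]; norm_num) ?_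
    exact (le_add_of_nonneg_right (sum_nonneg hnn)).trans hW
  · refine hfin i hi ((4 / 3) ^ (j - i)) ((3 / 4) ^ (j - i)) (by positivity)
      (by rw [← mul_pow]; norm_num) ?_
    have h1 := single_le_sum hnn (mem_range.2 hi)
    have h2 : 0 ≤ 2 ^ j * f (2 ^ 0) r := mul_nonneg (by positivity) (hf0 _ _)
    exact (h1.trans (le_add_of_nonneg_left h2)).trans hW

/-- In a sequence of polynomial growth there are radii of every scale at which the relative growth
is controlled at all smaller scales. -/
lemma exists_radii {b : ℕ → ℝ} (hb : Monotone b) (hb0 : ∀ n, 0 ≤ b n) {C : ℝ} {d : ℕ}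
    (hC : 1 ≤ C) (hbC : ∀ n : ℕ, 1 ≤ n → (n : ℝ) ^ d ≤ C * b n ∧ b n ≤ C * (n : ℝ) ^ d) :
    ∃ (K : ℝ) (r : ℕ → ℕ), 0 ≤ K ∧ r 0 = 0 ∧ ∀ j, 1 ≤ j → 2 ^ j ≤ r j ∧ r j < 2 ^ (j + 1) ∧
      b (r j + 1) ≤ (1 + K * (1 / 2) ^ j) * b (r j - 1) ∧
      ∀ i < j, b (r j + 2 ^ i) ≤ (1 + K * (3 / 4) ^ (j - i)) * b (r j - 2 ^ i) := by
  have hM : ∀ j, 1 ≤ j → b (2 ^ (j + 2)) ≤ C ^ 2 * 8 ^ d * b (2 ^ (j - 1)) := by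
    intro j hj
    have h1 := (hbC (2 ^ (j + 2)) Nat.one_le_two_pow).2
    have h2 := (hbC (2 ^ (j - 1)) Nat.one_le_two_pow).1
    have h3 : (2 : ℝ) ^ (j + 2) = 8 * 2 ^ (j - 1) := by
      obtain ⟨i, rfl⟩ := Nat.exists_eq_add_of_le' hj
      simp only [Nat.add_sub_cancel]
      ring
    push_cast at h1 h2
    rw [h3, mul_pow] at h1
    calc b (2 ^ (j + 2)) ≤ C * (8 ^ d * (2 ^ (j - 1)) ^ d) := h1
      _ ≤ C * (8 ^ d * (C * b (2 ^ (j - 1)))) := by gcongr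
      _ = _ := by ring
  have hex : ∀ j, ∃ r, (j = 0 → r = 0) ∧ (1 ≤ j → 2 ^ j ≤ r ∧ r < 2 ^ (j + 1) ∧
      b (r + 1) ≤ (1 + 6 * (C ^ 2 * 8 ^ d) * (1 / 2) ^ j) * b (r - 1) ∧
      ∀ i < j, b (r + 2 ^ i) ≤ (1 + 6 * (C ^ 2 * 8 ^ d) * (3 / 4) ^ (j - i)) * b (r - 2 ^ i)) := by
    intro j
    rcases Nat.eq_zero_or_pos j with rfl | hj
    · exact ⟨0, fun _ => rfl, fun h => absurd h (by norm_num)⟩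
    · obtain ⟨r, hr⟩ := exists_radius hb hb0 (by positivity) (hM j hj) hj
      exact ⟨r, fun h => absurd h hj.ne', fun _ => hr⟩
  choose r hr using hex
  exact ⟨6 * (C ^ 2 * 8 ^ d), r, by positivity, (hr 0).1 rfl, fun j hj => (hr j).2 hj⟩

end Radii

namespace IsLength

open scoped ENNReal
open Filter

variable {G : Type} [Group G] {L : G → ℕ}

/-- Radii of all scales along which the growth of balls is controlled. -/
structure IsAdapted (h : IsLength L) (d : ℕ) (C K : ℝ) (r : ℕ → ℕ) : Prop where
  one_le : 1 ≤ C
  nonneg : 0 ≤ K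
  le_card : ∀ n : ℕ, 1 ≤ n → (n : ℝ) ^ d ≤ C * (h.ball n).card
  card_le : ∀ n : ℕ, 1 ≤ n → ((h.ball n).card : ℝ) ≤ C * (n : ℝ) ^ d
  zero : r 0 = 0
  two_pow_le : ∀ j, 1 ≤ j → 2 ^ j ≤ r j
  lt_two_pow : ∀ j, r j < 2 ^ (j + 1)
  ratio_one : ∀ j, 1 ≤ j →
    ((h.ball (r j + 1)).card : ℝ) ≤ (1 + K * (1 / 2) ^ j) * (h.ball (r j - 1)).card
  ratio : ∀ j, 1 ≤ j → ∀ i < j, ((h.ball (r j + 2 ^ i)).card : ℝ) ≤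
    (1 + K * (3 / 4) ^ (j - i)) * (h.ball (r j - 2 ^ i)).card

variable {h : IsLength L} {d : ℕ} {C K : ℝ} {r : ℕ → ℕ}

variable (h) in
lemma exists_isAdapted (hC : 1 ≤ C) (hCd : ∀ n : ℕ, 1 ≤ n →
    (n : ℝ) ^ d ≤ C * (h.ball n).card ∧ ((h.ball n).card : ℝ) ≤ C * (n : ℝ) ^ d) :
    ∃ K r, h.IsAdapted d C K r := by
  obtain ⟨K, r, hK, hr0, hr⟩ := exists_radii (b := fun n => ((h.ball n).card : ℝ))
    (fun m n hmn => Nat.cast_le.2 (Finset.card_le_card (h.ball_mono hmn)))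
    (fun n => Nat.cast_nonneg _) hC hCd
  refine ⟨K, r, hC, hK, fun n hn => (hCd n hn).1, fun n hn => (hCd n hn).2, hr0,
    fun j hj => (hr j hj).1, fun j => ?_, fun j hj => (hr j hj).2.2.1, fun j hj => (hr j hj).2.2.2⟩
  rcases Nat.eq_zero_or_pos j with rfl | hj
  · simp [hr0]
  · exact (hr j hj).2.1

lemma natCast_div_le_ofReal {a b : ℕ} {c : ℝ} (hc : 0 ≤ c) (hab : (a : ℝ) ≤ c * b) :
    (a : ℝ≥0∞) / b ≤ ENNReal.ofReal c := by
  refine ENNReal.div_le_of_le_mul ?_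
  rw [← ENNReal.ofReal_natCast, ← ENNReal.ofReal_natCast, ← ENNReal.ofReal_mul hc]
  exact ENNReal.ofReal_le_ofReal hab

namespace IsAdapted

lemma ball_card_class_le (hr : h.IsAdapted d C K r) {ω : ℕ → G → ℝ}
    (hω : ∀ j, Function.Injective (ω j)) (k : ℕ) :
    ({z | Agree (h.label r ω) k 1 z}.ncard : ℝ) ≤ C * 4 ^ d * (2 ^ d) ^ k := by
  have hsub : {z | Agree (h.label r ω) k 1 z} ⊆ (h.ball (2 ^ (k + 2)) : Set G) := by
    intro z hz
    have h1 := h.le_of_rowMin_eq (hω k) (hz k le_rfl)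
    have h2 := hr.lt_two_pow k
    rw [Finset.mem_coe, mem_ball]
    rw [inv_one, one_mul] at h1
    rw [pow_succ] at h2 ⊢
    rw [pow_succ]
    omega
  have h1 := Set.ncard_le_ncard hsub (Finset.finite_toSet _)
  rw [Set.ncard_coe_finset] at h1
  calc ({z | Agree (h.label r ω) k 1 z}.ncard : ℝ) ≤ (h.ball (2 ^ (k + 2))).card := by
        exact_mod_cast h1
    _ ≤ C * ((2 ^ (k + 2) : ℕ) : ℝ) ^ d := hr.card_le _ Nat.one_le_two_pow
    _ = C * 4 ^ d * (2 ^ d) ^ k := by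
        have : (4 : ℝ) = 2 ^ 2 := by norm_num
        rw [mul_assoc, pow_right_comm, ← mul_pow, this, Nat.cast_pow, Nat.cast_ofNat, pow_add,
          mul_comm (2 ^ k : ℝ)]

lemma length_lt_of_agree (hr : h.IsAdapted d C K r) {ω : ℕ → G → ℝ}
    (hω : ∀ j, Function.Injective (ω j)) {k : ℕ} {z : G} (hz : Agree (h.label r ω) k 1 z) :
    L z ≤ 4 * 2 ^ k := by
  have h1 := h.le_of_rowMin_eq (hω k) (hz k le_rfl)
  have h2 := hr.lt_two_pow k
  rw [inv_one, one_mul] at h1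
  rw [pow_succ] at h2
  omega

lemma finite_class {ω : ℕ → G → ℝ} (hω : ∀ j, Function.Injective (ω j)) (k : ℕ) (x : G) :
    {y | Agree (h.label r ω) k x y}.Finite := by
  refine ((h.finite (2 * r k)).preimage (mul_right_injective x⁻¹).injOn).subset fun y hy => ?_
  exact h.le_of_rowMin_eq (hω k) (hy k le_rfl)

variable [Countable G]

lemma measure_label_ne_le (hr : h.IsAdapted d C K r) {j : ℕ} (hj : 1 ≤ j) {g : G} (hg : L g ≤ 1) :
    fieldLaw G {ω | h.label r ω j 1 ≠ h.label r ω j g} ≤ ENNReal.ofReal K * 2⁻¹ ^ j := by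
  have hK := hr.nonneg
  have h1 := (h.one_add_measure_label_ne_le ((Nat.one_le_two_pow).trans (hr.two_pow_le j hj))
    hg).trans (natCast_div_le_ofReal (by positivity) (hr.ratio_one j hj))
  rw [ENNReal.ofReal_add (by norm_num) (by positivity), ENNReal.ofReal_one,
    ENNReal.add_le_add_iff_left ENNReal.one_ne_top, ENNReal.ofReal_mul hK,
    ENNReal.ofReal_pow (by norm_num), one_div, ENNReal.ofReal_inv_of_pos (by norm_num)] at h1
  simpa using h1

lemma exists_measure_not_agree_le (hr : h.IsAdapted d C K r) (g : G) :
    ∃ A : ℝ≥0∞, A ≠ ∞ ∧ ∀ k : ℕ,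
      fieldLaw G {ω | ¬ Agree (h.label r ω) k 1 g} ≤ A * 2⁻¹ ^ k := by
  have hinv : ∀ (k : ℕ) (x y : G), fieldLaw G {ω | ¬ Agree (h.label r ω) k x (x * y)} =
      fieldLaw G {ω | ¬ Agree (h.label r ω) k 1 y} := by
    intro k x y
    have := measure_eq_measure_one (p := fun ω x => ¬ Agree (h.label r ω) k x (x * y))
      (fun x => (measurableSet_agree (h.measurable_label r) _ _ _).compl)
      (fun g ω x => by rw [agree_fieldAct, mul_assoc]) x
    simpa using this
  have hg : g ∈ Subgroup.closure {g | L g ≤ 1} := h.gen ▸ Subgroup.mem_top g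
  induction hg using Subgroup.closure_induction with
  | mem g hg =>
    refine ⟨1 + ENNReal.ofReal K * 2, by finiteness, fun k => ?_⟩
    rcases Nat.eq_zero_or_pos k with rfl | hk
    · rw [pow_zero, mul_one]
      exact prob_le_one.trans le_self_add
    · have hsub : {ω | ¬ Agree (h.label r ω) k 1 g} ⊆
          ⋃ i, {ω | h.label r ω (k + i) 1 ≠ h.label r ω (k + i) g} := by
        intro ω hω
        simp only [Set.mem_ofPred_eq, Agree, not_forall] at hω
        obtain ⟨j, hj, hne⟩ := hω
        exact Set.mem_iUnion.2 ⟨j - k, by simpa [Nat.add_sub_cancel' hj] using hne⟩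
      calc fieldLaw G {ω | ¬ Agree (h.label r ω) k 1 g}
          ≤ ∑' i, fieldLaw G {ω | h.label r ω (k + i) 1 ≠ h.label r ω (k + i) g} :=
            (measure_mono hsub).trans (measure_iUnion_le _)
        _ ≤ ∑' i, ENNReal.ofReal K * 2⁻¹ ^ k * 2⁻¹ ^ i := by
            refine ENNReal.tsum_le_tsum fun i => ?_
            rw [mul_assoc, ← pow_add]
            exact hr.measure_label_ne_le (by omega) hg
        _ = ENNReal.ofReal K * 2 * 2⁻¹ ^ k := by
            rw [ENNReal.tsum_mul_left, ENNReal.tsum_geometric, ENNReal.one_sub_inv_two, inv_inv]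
            ring
        _ ≤ _ := mul_le_mul_left le_add_self _
  | one => exact ⟨0, ENNReal.zero_ne_top, fun k => by simp [Agree]⟩
  | mul x y _ _ hx hy =>
    obtain ⟨A, hA, hAk⟩ := hx
    obtain ⟨B, hB, hBk⟩ := hy
    refine ⟨A + B, by finiteness, fun k => ?_⟩
    rw [add_mul]
    refine le_trans (measure_mono fun ω hω => ?_) ((measure_union_le _ _).trans
      (add_le_add (hAk k) ((hinv k x y).trans_le (hBk k))))
    by_contra hcon
    simp only [Set.mem_union, Set.mem_ofPred_eq, not_or, not_not] at hcon
    exact hω (hcon.1.trans hcon.2)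
  | inv x _ hx =>
    obtain ⟨A, hA, hAk⟩ := hx
    refine ⟨A, hA, fun k => ?_⟩
    have := hinv k x x⁻¹
    rw [mul_inv_cancel] at this
    rw [← this]
    refine le_trans (measure_mono fun ω hω => ?_) (hAk k)
    exact fun hcon => hω hcon.symm

lemma ae_exists_agree (hr : h.IsAdapted d C K r) :
    ∀ᵐ ω ∂fieldLaw G, ∀ x y, ∃ k, Agree (h.label r ω) k x y := by
  have hone : ∀ y, fieldLaw G {ω | ∀ k, ¬ Agree (h.label r ω) k 1 y} = 0 := by
    intro y
    obtain ⟨A, hA, hAk⟩ := hr.exists_measure_not_agree_le y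
    have hlim : Tendsto (fun k : ℕ => A * (2⁻¹ : ℝ≥0∞) ^ k) atTop (nhds 0) := by
      have := ENNReal.Tendsto.const_mul (a := A)
        (ENNReal.tendsto_pow_atTop_nhds_zero_of_lt_one (r := 2⁻¹) (by simp)) (Or.inr hA)
      simpa using this
    exact le_antisymm (ge_of_tendsto' hlim fun k =>
      (measure_mono (t := {ω | ¬ Agree (h.label r ω) k 1 y}) fun ω hω =>
        (show ∀ k, ¬ Agree (h.label r ω) k 1 y from hω) k).trans (hAk k)) zero_le
  rw [ae_all_iff]
  intro x
  rw [ae_all_iff]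
  intro y
  have := measure_eq_measure_one
    (p := fun ω z => ∀ k, ¬ Agree (h.label r ω) k z (z * (x⁻¹ * y)))
    (fun z => by
      simp only [Set.ofPred_forall]
      exact .iInter fun k => (measurableSet_agree (h.measurable_label r) _ _ _).compl)
    (fun g ω z => by simp only [agree_fieldAct, mul_assoc]) x
  rw [one_mul, hone, mul_inv_cancel_left] at this
  simpa [ae_iff] using this

omit [Countable G] in
lemma prod_ratio_le (hr : h.IsAdapted d C K r) {k : ℕ} (hk : 1 ≤ k) (M : ℕ) :
    ∏ j ∈ Finset.Ico k M, (((h.ball (r j + 2 ^ (k - 1))).card : ℝ≥0∞) /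
      (h.ball (r j - 2 ^ (k - 1))).card) ≤ ENNReal.ofReal (Real.exp (3 * K)) := by
  have hK := hr.nonneg
  calc ∏ j ∈ Finset.Ico k M, (((h.ball (r j + 2 ^ (k - 1))).card : ℝ≥0∞) /
        (h.ball (r j - 2 ^ (k - 1))).card)
      ≤ ∏ j ∈ Finset.Ico k M, ENNReal.ofReal (Real.exp (K * (3 / 4) ^ (j - (k - 1)))) := by
        refine Finset.prod_le_prod' fun j hj => ?_
        have hj' := Finset.mem_Ico.1 hj
        refine (natCast_div_le_ofReal (by positivity) (hr.ratio j (by omega) (k - 1)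
          (by omega))).trans (ENNReal.ofReal_le_ofReal ?_)
        rw [add_comm]
        exact Real.add_one_le_exp _
    _ = ENNReal.ofReal (Real.exp (K * ∑ j ∈ Finset.Ico k M, (3 / 4) ^ (j - (k - 1)))) := by
        rw [← ENNReal.ofReal_prod_of_nonneg fun _ _ => (Real.exp_pos _).le, ← Real.exp_sum,
          Finset.mul_sum]
    _ ≤ ENNReal.ofReal (Real.exp (3 * K)) := by
        refine ENNReal.ofReal_le_ofReal (Real.exp_le_exp.2 ?_)
        rw [mul_comm 3 K]
        refine mul_le_mul_of_nonneg_left ?_ hK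
        rw [Finset.sum_Ico_eq_sum_range]
        have : ∀ i, (3 / 4 : ℝ) ^ (k + i - (k - 1)) = 3 / 4 * (3 / 4) ^ i := by
          intro i
          rw [← pow_succ']
          congr 1
          omega
        simp_rw [this]
        rw [← Finset.mul_sum, geom_sum_eq (by norm_num),
          show (3 / 4 : ℝ) - 1 = -(1 / 4) by norm_num, div_neg, div_div_eq_mul_div, div_one]
        have := pow_pos (by norm_num : (0 : ℝ) < 3 / 4) (M - k)
        linarith

lemma measure_selected_le (hr : h.IsAdapted d C K r) {p : (ℕ → G → ℝ) → G → Prop}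
    (hp : ∀ x, MeasurableSet {ω | p ω x})
    (hact : ∀ g ω x, p (fieldAct g ω) x ↔ p ω (g⁻¹ * x)) {k : ℕ}
    (hsep : ∀ᵐ ω ∂fieldLaw G, ∀ x y, p ω x → p ω y → Agree (h.label r ω) k x y → x = y) :
    fieldLaw G {ω | p ω 1} ≤ ENNReal.ofReal (Real.exp (3 * K) * C * 2 ^ d) * ((2 ^ d)⁻¹) ^ k := by
  have hC := hr.one_le
  rcases Nat.eq_zero_or_pos k with rfl | hk
  · rw [pow_zero, mul_one]
    refine prob_le_one.trans (ENNReal.one_le_ofReal.2 ?_)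
    have h1 : 1 ≤ Real.exp (3 * K) := Real.one_le_exp (by linarith [hr.nonneg])
    have h2 : (1 : ℝ) ≤ 2 ^ d := one_le_pow₀ (by norm_num)
    exact one_le_mul_of_one_le_of_one_le (one_le_mul_of_one_le_of_one_le h1 hC) h2
  · have h1 := h.card_ball_mul_measure_le hp hact hsep (t := 2 ^ (k - 1))
      (fun j hj => (Nat.pow_le_pow_right (by norm_num) (by omega)).trans
        (hr.two_pow_le j (by omega))) (hr.prod_ratio_le hk)
    have h2 := hr.le_card (2 ^ (k - 1)) Nat.one_le_two_pow
    have h3 : fieldLaw G {ω | p ω 1} = ENNReal.ofReal ((fieldLaw G {ω | p ω 1}).toReal) :=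
      (ENNReal.ofReal_toReal (measure_ne_top _ _)).symm
    set q := (fieldLaw G {ω | p ω 1}).toReal with hq
    have hq0 : 0 ≤ q := ENNReal.toReal_nonneg
    rw [h3, ← ENNReal.ofReal_natCast, ← ENNReal.ofReal_mul (Nat.cast_nonneg _),
      ENNReal.ofReal_le_ofReal_iff (Real.exp_pos _).le] at h1
    have h4 : ((2 : ℝ≥0∞) ^ d)⁻¹ ^ k = ENNReal.ofReal (((2 ^ d)⁻¹) ^ k) := by
      rw [ENNReal.ofReal_pow (by positivity), ENNReal.ofReal_inv_of_pos (by positivity),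
        ENNReal.ofReal_pow (by norm_num), ENNReal.ofReal_ofNat]
    rw [h3, h4, ← ENNReal.ofReal_mul (by positivity)]
    refine ENNReal.ofReal_le_ofReal ?_
    have hpos : 0 < ((2 : ℝ) ^ d) ^ k := by positivity
    rw [inv_pow, ← div_eq_mul_inv, le_div_iff₀ hpos]
    have h5 : ((2 : ℝ) ^ d) ^ k = 2 ^ d * ((2 ^ (k - 1) : ℕ) : ℝ) ^ d := by
      obtain ⟨i, rfl⟩ := Nat.exists_eq_add_of_le' hk
      rw [Nat.add_sub_cancel, pow_succ', Nat.cast_pow, Nat.cast_ofNat, pow_right_comm]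
    rw [h5]
    calc q * (2 ^ d * ((2 ^ (k - 1) : ℕ) : ℝ) ^ d)
        ≤ q * (2 ^ d * (C * (h.ball (2 ^ (k - 1))).card)) :=
          mul_le_mul_of_nonneg_left (mul_le_mul_of_nonneg_left h2 (by positivity)) hq0
      _ = C * 2 ^ d * ((h.ball (2 ^ (k - 1))).card * q) := by ring
      _ ≤ C * 2 ^ d * Real.exp (3 * K) := mul_le_mul_of_nonneg_left h1 (by positivity)
      _ = _ := by ring

end IsAdapted

end IsLength

namespace IsLength.IsAdapted

open scoped ENNReal
open Filter

variable {G : Type} [Group G] {L : G → ℕ} {h : IsLength L} {d : ℕ} {C K : ℝ} {r : ℕ → ℕ}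

lemma injective_label_zero (hr : h.IsAdapted d C K r) {ω : ℕ → G → ℝ}
    (hω : ∀ j, Function.Injective (ω j)) : Function.Injective (h.label r ω 0) := by
  have : h.label r ω 0 = ω 0 := by
    funext x
    rw [label, hr.zero, rowMin_zero]
  rw [this]
  exact hω 0

variable [Countable G]

/-- The probability that the identity is extremal in its class of level `k`. -/
lemma measure_extremal_le (hr : h.IsAdapted d C K r) {R : (ℕ → G → ℝ) → G → G → Prop}
    (hR : ∀ x y, MeasurableSet {ω | R ω x y})
    (hact : ∀ g ω x y, R (fieldAct g ω) x y ↔ R ω (g⁻¹ * x) (g⁻¹ * y)) {k : ℕ}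
    (htri : ∀ᵐ ω ∂fieldLaw G, ∀ x y, Agree (h.label r ω) k x y → R ω x y ∨ x = y ∨ R ω y x) :
    fieldLaw G {ω | ∀ w, Agree (h.label r ω) k 1 w → ¬ R ω 1 w} ≤
      ENNReal.ofReal (Real.exp (3 * K) * C * 2 ^ d) * ((2 ^ d)⁻¹) ^ k := by
  refine hr.measure_selected_le (p := fun ω x => ∀ w, Agree (h.label r ω) k x w → ¬ R ω x w)
    (fun x => ?_) (fun g ω x => ?_) ?_
  · simp only [Set.ofPred_forall, imp_iff_not_or]
    exact .iInter fun w => (measurableSet_agree (h.measurable_label r) _ _ _).compl.union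
      (hR x w).compl
  · simp only [agree_fieldAct, hact]
    exact (Group.mulLeft_bijective g⁻¹).2.forall
      (p := fun w => Agree (h.label r ω) k (g⁻¹ * x) w → ¬ R ω (g⁻¹ * x) w) |>.symm
  · filter_upwards [htri] with ω hω x y hx hy hxy
    rcases hω x y hxy with h1 | h1 | h1
    · exact absurd h1 (hx y hxy)
    · exact h1
    · exact absurd h1 (hy x hxy.symm)

lemma ae_exists_rel (hr : h.IsAdapted d C K r) (hd : 1 ≤ d) {R : (ℕ → G → ℝ) → G → G → Prop}
    (hR : ∀ x y, MeasurableSet {ω | R ω x y})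
    (hact : ∀ g ω x y, R (fieldAct g ω) x y ↔ R ω (g⁻¹ * x) (g⁻¹ * y))
    (htri : ∀ᵐ ω ∂fieldLaw G, ∀ k x y, Agree (h.label r ω) k x y → R ω x y ∨ x = y ∨ R ω y x) :
    ∀ᵐ ω ∂fieldLaw G, ∀ x, ∃ y, R ω x y := by
  have hone : fieldLaw G {ω | ∀ w, ¬ R ω 1 w} = 0 := by
    have hlim : Tendsto (fun k : ℕ => ENNReal.ofReal (Real.exp (3 * K) * C * 2 ^ d) *
        (((2 : ℝ≥0∞) ^ d)⁻¹) ^ k) atTop (nhds 0) := by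
      have hlt : ((2 : ℝ≥0∞) ^ d)⁻¹ < 1 := by
        rw [ENNReal.inv_lt_one]
        exact one_lt_pow₀ (by norm_num) (by omega)
      simpa using ENNReal.Tendsto.const_mul (ENNReal.tendsto_pow_atTop_nhds_zero_of_lt_one hlt)
        (Or.inr ENNReal.ofReal_ne_top)
    refine le_antisymm (ge_of_tendsto' hlim fun k => ?_) zero_le
    refine (measure_mono fun ω hω => ?_).trans (hr.measure_extremal_le hR hact (k := k) ?_)
    · exact fun w _ => (show ∀ w, ¬ R ω 1 w from hω) w
    · filter_upwards [htri] with ω hω using hω k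
  rw [ae_all_iff]
  intro x
  have := measure_eq_measure_one (p := fun ω x => ∀ w, ¬ R ω x w)
    (fun z => by
      simp only [Set.ofPred_forall]
      exact .iInter fun w => (hR z w).compl)
    (fun g ω z => by
      simp only [hact]
      exact (Group.mulLeft_bijective g⁻¹).2.forall
        (p := fun w => ¬ R ω (g⁻¹ * z) w) |>.symm) x
  rw [hone] at this
  simpa [ae_iff] using this

lemma ae_isLabelling (hr : h.IsAdapted d C K r) (hd : 1 ≤ d) :
    ∀ᵐ ω ∂fieldLaw G, IsLabelling (h.label r ω) := by
  have htri : ∀ᵐ ω ∂fieldLaw G, ∀ k x y, Agree (h.label r ω) k x y →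
      Below (h.label r ω) x y ∨ x = y ∨ Below (h.label r ω) y x := by
    filter_upwards [fieldLaw_ae_injective] with ω hω k x y hxy
    exact hxy.below_trichotomy (hr.injective_label_zero hω)
  have htri' : ∀ᵐ ω ∂fieldLaw G, ∀ k x y, Agree (h.label r ω) k x y →
      Below (h.label r ω) y x ∨ x = y ∨ Below (h.label r ω) x y := by
    filter_upwards [htri] with ω hω k x y hxy
    have := hω k x y hxy
    tauto
  filter_upwards [fieldLaw_ae_injective, hr.ae_exists_agree,
    hr.ae_exists_rel hd (R := fun ω x y => Below (h.label r ω) x y)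
      (measurableSet_below (h.measurable_label r)) (fun g ω x y => h.below_fieldAct r g ω x y) htri,
    hr.ae_exists_rel hd (R := fun ω x y => Below (h.label r ω) y x)
      (fun x y => measurableSet_below (h.measurable_label r) y x)
      (fun g ω x y => h.below_fieldAct r g ω y x) htri'] with ω h1 h2 h3 h4
  exact ⟨hr.injective_label_zero h1, h2, finite_class h1, h3, h4⟩

end IsLength.IsAdapted

namespace IsLength

open scoped ENNReal
open Filter

section Good

variable {G : Type} [Group G] {L : G → ℕ} (h : IsLength L) (r : ℕ → ℕ)

/-- The label sequences for which the antilexicographic order is isomorphic to `ℤ`. -/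
def goodFields : Set (ℕ → G → ℝ) :=
  {ω | (∀ j, Function.Injective (ω j)) ∧ IsLabelling (h.label r ω)}

variable {h r}

lemma isLabelling_fieldAct {g : G} {ω : ℕ → G → ℝ} (hω : IsLabelling (h.label r ω)) :
    IsLabelling (h.label r (fieldAct g ω)) where
  inj x y hxy := by
    rw [label_fieldAct, label_fieldAct] at hxy
    exact mul_right_injective g⁻¹ (hω.inj hxy)
  agree x y := by
    obtain ⟨k, hk⟩ := hω.agree (g⁻¹ * x) (g⁻¹ * y)
    exact ⟨k, (h.agree_fieldAct r g ω k x y).2 hk⟩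
  finite k x := by
    simp only [agree_fieldAct]
    exact (hω.finite k (g⁻¹ * x)).preimage (mul_right_injective g⁻¹).injOn
  exists_above x := by
    obtain ⟨y, hy⟩ := hω.exists_above (g⁻¹ * x)
    exact ⟨g * y, (h.below_fieldAct r g ω _ _).2 (by rwa [inv_mul_cancel_left])⟩
  exists_below x := by
    obtain ⟨y, hy⟩ := hω.exists_below (g⁻¹ * x)
    exact ⟨g * y, (h.below_fieldAct r g ω _ _).2 (by rwa [inv_mul_cancel_left])⟩

lemma fieldAct_mem_goodFields (g : G) {ω : ℕ → G → ℝ} (hω : ω ∈ h.goodFields r) :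
    fieldAct g ω ∈ h.goodFields r :=
  ⟨fun j _ _ hxy => mul_right_injective g⁻¹ (hω.1 j hxy), isLabelling_fieldAct hω.2⟩

lemma fieldAct_mem_goodFields_iff {g : G} {ω : ℕ → G → ℝ} :
    fieldAct g ω ∈ h.goodFields r ↔ ω ∈ h.goodFields r := by
  refine ⟨fun hω => ?_, fieldAct_mem_goodFields g⟩
  have := fieldAct_mem_goodFields g⁻¹ hω
  rwa [← fieldAct_mul, inv_mul_cancel, fieldAct_one] at this

end Good

namespace IsAdapted

variable {G : Type} [Group G] {L : G → ℕ} {h : IsLength L} {d : ℕ} {C K : ℝ} {r : ℕ → ℕ}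
variable [Countable G]

lemma measurableSet_goodFields (hr : h.IsAdapted d C K r) :
    MeasurableSet (h.goodFields r) := by
  have hset : h.goodFields r = (⋂ j, ⋂ x, ⋂ y, {ω | ω j x = ω j y → x = y}) ∩
      ((⋂ x, ⋂ y, ⋃ k, {ω | Agree (h.label r ω) k x y}) ∩
      ((⋂ x, ⋃ y, {ω | Below (h.label r ω) x y}) ∩
        ⋂ x, ⋃ y, {ω | Below (h.label r ω) y x})) := by
    ext ω
    simp only [goodFields, Function.Injective, Set.mem_inter_iff, Set.mem_iInter, Set.mem_iUnion,
      Set.mem_ofPred_eq]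
    exact and_congr_right fun hω => ⟨fun hl => ⟨hl.agree, hl.exists_above, hl.exists_below⟩,
      fun hl => ⟨hr.injective_label_zero hω, hl.1,
        finite_class hω, hl.2.1, hl.2.2⟩⟩
  rw [hset]
  refine .inter (.iInter fun j => .iInter fun x => .iInter fun y => ?_) (.inter
    (.iInter fun x => .iInter fun y => .iUnion fun k =>
      measurableSet_agree (h.measurable_label r) k x y) (.inter
    (.iInter fun x => .iUnion fun y => measurableSet_below (h.measurable_label r) x y)
    (.iInter fun x => .iUnion fun y => measurableSet_below (h.measurable_label r) y x)))
  have : MeasurableSet {ω : ℕ → G → ℝ | ω j x = ω j y} :=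
    measurableSet_eq_fun (by fun_prop) (by fun_prop)
  simp only [imp_iff_not_or]
  exact this.compl.union (.const _)

lemma ae_mem_goodFields (hr : h.IsAdapted d C K r) (hd : 1 ≤ d) :
    ∀ᵐ ω ∂fieldLaw G, ω ∈ h.goodFields r := by
  filter_upwards [fieldLaw_ae_injective, hr.ae_isLabelling hd] with ω h1 h2 using ⟨h1, h2⟩

open Classical in
/-- The coupling of `G` with `ℤ` given by the antilexicographic order on each orbit. -/
noncomputable def intCoupling (hr : h.IsAdapted d C K r) (hd : 1 ≤ d) : IntCoupling G where
  Ω := ℕ → G → ℝ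
  μ := fieldLaw G
  act := fieldAct
  act_one := fieldAct_one
  act_mul := fieldAct_mul
  act_pres := fieldAct_pres
  act_free := by
    filter_upwards [fieldLaw_ae_injective] with ω hω g hg
    have := hω 0 (congrFun (congrFun hg 0) 1)
    simpa using this
  good := h.goodFields r
  good_meas := hr.measurableSet_goodFields
  good_ae := hr.ae_mem_goodFields hd
  good_act g ω := fieldAct_mem_goodFields g
  pos g ω := if ω ∈ h.goodFields r then orderGap (h.label r ω) 1 g⁻¹ else 0
  pos_mul g g' ω := by
    by_cases hω : ω ∈ h.goodFields r
    · rw [if_pos hω, if_pos hω, if_pos (fieldAct_mem_goodFields g' hω), orderGap_fieldAct,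
        hω.2.orderGap_add 1 g'⁻¹, mul_one, mul_inv_rev, add_comm]
    · rw [if_neg hω, if_neg hω, if_neg (fieldAct_mem_goodFields_iff.not.2 hω), add_zero]
  pos_meas g v := by
    have : Measurable fun ω => if ω ∈ h.goodFields r then orderGap (h.label r ω) 1 g⁻¹ else 0 :=
      (measurable_orderGap (h.measurable_label r) 1 g⁻¹).ite hr.measurableSet_goodFields
        measurable_const
    exact this (measurableSet_singleton v)
  pos_bij ω hω := by
    simp only [if_pos hω]
    exact (hω.2.orderGap_bijective 1).comp inv_involutive.bijective

section Tails

variable (hr : h.IsAdapted d C K r) (hd : 1 ≤ d)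

lemma intCoupling_pos {ω : ℕ → G → ℝ} (hω : ω ∈ h.goodFields r) (g : G) :
    (hr.intCoupling hd).pos g ω = orderGap (h.label r ω) 1 g⁻¹ := if_pos hω

lemma intCoupling_pos_of_notMem {ω : ℕ → G → ℝ} (hω : ω ∉ h.goodFields r) (g : G) :
    (hr.intCoupling hd).pos g ω = 0 := if_neg hω

/-- The points which are maximal in their class of level `k`. -/
def maximalFields (h : IsLength L) (r : ℕ → ℕ) (k : ℕ) : Set (ℕ → G → ℝ) :=
  {ω | ∀ w, Agree (h.label r ω) k 1 w → ¬ Below (h.label r ω) 1 w}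

lemma exists_shift_mem_maximalFields {ω : ℕ → G → ℝ} (hω : ω ∈ h.goodFields r) {v k : ℕ}
    (hv : 4 * 2 ^ k < L ((hr.intCoupling hd).elt v ω)) :
    ∃ i < v, (hr.intCoupling hd).shift i ω ∈ maximalFields h r k := by
  have hpos : orderGap (h.label r ω) 1 ((hr.intCoupling hd).elt v ω)⁻¹ = v :=
    (hr.intCoupling_pos hd hω _).symm.trans (IntCoupling.pos_elt hω _)
  have hag : ¬ Agree (h.label r ω) k 1 ((hr.intCoupling hd).elt v ω)⁻¹ := by
    intro hag
    have := hr.length_lt_of_agree hω.1 hag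
    rw [h.inv] at this
    omega
  obtain ⟨i, hi, z, hz, hmax⟩ := hω.2.exists_isMax hpos hag
  have hiz : (hr.intCoupling hd).elt i ω = z⁻¹ :=
    (IntCoupling.elt_eq_iff (c := hr.intCoupling hd) hω).2 <| by
      rw [hr.intCoupling_pos hd hω, inv_inv, hz]
  refine ⟨i, hi, fun w hw hw' => ?_⟩
  have hs : (hr.intCoupling hd).shift i ω = fieldAct z⁻¹ ω :=
    congrArg (fun g => fieldAct g ω) hiz
  rw [hs, agree_fieldAct, inv_inv, mul_one] at hw
  rw [hs, below_fieldAct, inv_inv, mul_one] at hw'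
  exact hmax _ hw hw'

lemma measure_maximalFields_le (hr : h.IsAdapted d C K r) (k : ℕ) :
    fieldLaw G (maximalFields h r k) ≤
      ENNReal.ofReal (Real.exp (3 * K) * C * 2 ^ d) * ((2 ^ d)⁻¹) ^ k := by
  refine hr.measure_extremal_le (R := fun ω x y => Below (h.label r ω) x y)
    (measurableSet_below (h.measurable_label r)) (fun g ω x y => h.below_fieldAct r g ω x y) ?_
  filter_upwards [fieldLaw_ae_injective] with ω hω x y hxy
  exact hxy.below_trichotomy (hr.injective_label_zero hω)

lemma measurableSet_maximalFields (k : ℕ) : MeasurableSet (maximalFields h r k) := by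
  simp only [maximalFields, Set.ofPred_forall, imp_iff_not_or]
  exact .iInter fun w => (measurableSet_agree (h.measurable_label r) _ _ _).compl.union
    (measurableSet_below (h.measurable_label r) _ _).compl

lemma measure_lt_elt_le (v k : ℕ) :
    (hr.intCoupling hd).μ {ω | 4 * 2 ^ k < L ((hr.intCoupling hd).elt v ω)} ≤
      v * (ENNReal.ofReal (Real.exp (3 * K) * C * 2 ^ d) * ((2 ^ d)⁻¹) ^ k) := by
  have hsub : {ω | 4 * 2 ^ k < L ((hr.intCoupling hd).elt v ω)} ⊆
      ⋃ i ∈ Finset.range v, (hr.intCoupling hd).shift i ⁻¹' maximalFields h r k := by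
    intro ω hv
    by_cases hω : ω ∈ h.goodFields r
    · obtain ⟨i, hi, hmem⟩ := hr.exists_shift_mem_maximalFields hd hω hv
      exact Set.mem_biUnion (Finset.mem_coe.2 (Finset.mem_range.2 hi)) hmem
    · rw [Set.mem_ofPred_eq, IntCoupling.elt_of_notMem hω, h.one] at hv
      omega
  refine (measure_mono hsub).trans ((measure_biUnion_finset_le _ _).trans ?_)
  calc ∑ i ∈ Finset.range v, fieldLaw G ((hr.intCoupling hd).shift i ⁻¹' maximalFields h r k)
      = ∑ i ∈ Finset.range v, fieldLaw G (maximalFields h r k) :=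
        Finset.sum_congr rfl fun i _ => (IntCoupling.shift_pres (c := hr.intCoupling hd)
          i).measure_preimage (measurableSet_maximalFields k).nullMeasurableSet
    _ = v * fieldLaw G (maximalFields h r k) := by
        rw [Finset.sum_const, Finset.card_range, nsmul_eq_mul]
    _ ≤ _ := by
        gcongr
        exact hr.measure_maximalFields_le k

lemma measure_lt_elt_natAbs_le (v : ℤ) (k : ℕ) :
    (hr.intCoupling hd).μ {ω | 4 * 2 ^ k < L ((hr.intCoupling hd).elt v ω)} ≤
      v.natAbs * (ENNReal.ofReal (Real.exp (3 * K) * C * 2 ^ d) * ((2 ^ d)⁻¹) ^ k) := by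
  obtain ⟨n, rfl | rfl⟩ := v.eq_nat_or_neg
  · exact hr.measure_lt_elt_le hd n k
  · rw [Int.natAbs_neg]
    refine le_of_eq_of_le ?_ (hr.measure_lt_elt_le hd n k)
    have hm : MeasurableSet {ω | 4 * 2 ^ k < L ((hr.intCoupling hd).elt n ω)} :=
      measurableSet_lt measurable_const
        (IntCoupling.measurable_comp_of_fibers (IntCoupling.elt_meas (n : ℤ)) L)
    rw [← (IntCoupling.shift_pres (c := hr.intCoupling hd) (-(n : ℤ))).measure_preimage
      hm.nullMeasurableSet]
    congr 1
    ext ω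
    simp [IntCoupling.elt_neg, h.inv]

lemma intCoupling_hasTails : (hr.intCoupling hd).HasTails L d where
  pos_tail := by
    have hC := hr.one_le
    refine ⟨ENNReal.ofReal (C * 4 ^ d), ?_, ENNReal.ofReal_ne_top, fun g => ?_⟩
    · exact ENNReal.one_le_ofReal.2
        (one_le_mul_of_one_le_of_one_le hC (one_le_pow₀ (by norm_num)))
    obtain ⟨A, hA, hAk⟩ := hr.exists_measure_not_agree_le g⁻¹
    refine ⟨A, hA, fun k => (measure_mono fun ω hω => ?_).trans (hAk k)⟩
    intro hag
    by_cases hgood : ω ∈ h.goodFields r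
    · have h1 := hgood.2.natAbs_orderGap_le hag
      have h2 := hr.ball_card_class_le hgood.1 k
      have h3 : ((orderGap (h.label r ω) 1 g⁻¹).natAbs : ℝ) ≤ C * 4 ^ d * (2 ^ d) ^ k :=
        (Nat.cast_le.2 h1).trans h2
      rw [Set.mem_ofPred_eq, hr.intCoupling_pos hd hgood] at hω
      refine absurd hω (not_lt.2 ?_)
      calc ((orderGap (h.label r ω) 1 g⁻¹).natAbs : ℝ≥0∞)
          ≤ ENNReal.ofReal (C * 4 ^ d * (2 ^ d) ^ k) := by
            rw [← ENNReal.ofReal_natCast]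
            exact ENNReal.ofReal_le_ofReal h3
        _ = _ := by
            rw [ENNReal.ofReal_mul (by positivity), ENNReal.ofReal_pow (by positivity),
              ENNReal.ofReal_pow (by norm_num), ENNReal.ofReal_ofNat]
    · rw [Set.mem_ofPred_eq, hr.intCoupling_pos_of_notMem hd hgood] at hω
      simp at hω
  elt_tail := by
    refine ⟨4 + ENNReal.ofReal (Real.exp (3 * K) * C * 2 ^ d), ?_, by finiteness, fun v k => ?_⟩
    · exact le_add_right (by norm_num)
    refine (measure_mono fun ω hω => ?_).trans ((hr.measure_lt_elt_natAbs_le hd v k).trans ?_)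
    · have h1 : (4 : ℝ≥0∞) * 2 ^ k < (L ((hr.intCoupling hd).elt v ω) : ℝ≥0∞) :=
        lt_of_le_of_lt (by gcongr; exact le_self_add) hω
      exact_mod_cast h1
    · rw [← mul_assoc, mul_comm (v.natAbs : ℝ≥0∞)]
      gcongr
      exact le_add_self

end Tails

end IsAdapted

end IsLength

section WordLength

open scoped Pointwise

variable {Γ : Type*} [Group Γ] {S : Set Γ}

lemma exists_mem_pow (hsymm : S⁻¹ = S) (hgen : Subgroup.closure S = ⊤) (g : Γ) :
    ∃ n : ℕ, g ∈ S ^ n := by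
  have hg : g ∈ Subgroup.closure S := hgen ▸ Subgroup.mem_top g
  induction hg using Subgroup.closure_induction with
  | mem g hg => exact ⟨1, by rwa [pow_one]⟩
  | one => exact ⟨0, by simp⟩
  | mul g g' _ _ hg hg' =>
    obtain ⟨n, hn⟩ := hg
    obtain ⟨n', hn'⟩ := hg'
    exact ⟨n + n', pow_add S n n' ▸ Set.mul_mem_mul hn hn'⟩
  | inv g _ hg =>
    obtain ⟨n, hn⟩ := hg
    refine ⟨n, ?_⟩
    rwa [← hsymm, inv_pow, Set.inv_mem_inv]

lemma wordLength_le_iff (hsymm : S⁻¹ = S) (hone : 1 ∈ S) (hgen : Subgroup.closure S = ⊤) {g : Γ}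
    {n : ℕ} : wordLength S g ≤ n ↔ g ∈ S ^ n :=
  ⟨fun h => Set.pow_subset_pow_right hone h (Nat.sInf_mem (exists_mem_pow hsymm hgen g)),
    fun h => Nat.sInf_le h⟩

lemma isLength_wordLength (hfin : S.Finite) (hsymm : S⁻¹ = S) (hone : 1 ∈ S)
    (hgen : Subgroup.closure S = ⊤) : IsLength (wordLength S) := by
  have hle : ∀ {g : Γ} {n : ℕ}, wordLength S g ≤ n ↔ g ∈ S ^ n :=
    wordLength_le_iff hsymm hone hgen
  have hinv : ∀ g, wordLength S g⁻¹ ≤ wordLength S g := by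
    intro g
    have := Set.inv_mem_inv.2 ((hle (g := g)).1 le_rfl)
    rwa [← inv_pow, hsymm, ← hle] at this
  refine ⟨?_, fun g g' => ?_, fun g => ?_, fun g hg => ?_, ?_, fun n => ?_⟩
  · rw [← Nat.le_zero, hle]
    simp
  · rw [hle, pow_add]
    exact Set.mul_mem_mul (hle.1 le_rfl) (hle.1 le_rfl)
  · exact (hinv g).antisymm (by simpa using hinv g⁻¹)
  · simpa using hle.1 hg.le
  · rw [eq_top_iff, ← hgen]
    exact Subgroup.closure_mono fun g hg => hle.2 (by rwa [pow_one])
  · have hpow : (S ^ n).Finite := by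
      induction n with
      | zero => simp
      | succ n ih => exact pow_succ S n ▸ ih.mul hfin
    exact hpow.subset fun g hg => hle.1 hg

end WordLength

lemma IsLength.comp_mulEquiv {Γ G : Type*} [Group Γ] [Group G] {L : Γ → ℕ} (h : IsLength L)
    (e : G ≃* Γ) : IsLength fun g => L (e g) where
  one := by rw [map_one, h.one]
  mul_le g g' := by
    rw [map_mul]
    exact h.mul_le _ _
  inv g := by rw [map_inv, h.inv]
  eq_one g hg := e.map_eq_one_iff.1 (h.eq_one _ hg)
  gen := by
    have := congrArg (Subgroup.map e.symm.toMonoidHom) h.gen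
    rw [MonoidHom.map_closure, Subgroup.map_top_of_surjective _ e.symm.surjective] at this
    convert this using 2
    exact (e.symm.toEquiv.image_eq_preimage_symm {g | L g ≤ 1}).symm
  finite r := (h.finite r).preimage e.injective.injOn

lemma IsLength.countable {G : Type*} [Group G] {L : G → ℕ} (h : IsLength L) : Countable G := by
  have : (⋃ r, {g | L g ≤ r}) = Set.univ :=
    Set.eq_univ_of_forall fun g => Set.mem_iUnion.2 ⟨L g, le_refl (L g)⟩
  rw [← Set.countable_univ_iff, ← this]
  exact Set.countable_iUnion fun r => (h.finite r).countable

namespace IntCoupling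

variable {Γ : Type u} {G : Type v} [Group Γ] [Group G]

/-- Transport of an integer coupling along an isomorphism of groups. -/
def comapMulEquiv (c : IntCoupling G) (e : Γ ≃* G) : IntCoupling Γ where
  Ω := c.Ω
  μ := c.μ
  act g := c.act (e g)
  act_one ω := by rw [map_one, c.act_one]
  act_mul g g' ω := by rw [map_mul, c.act_mul]
  act_pres g := c.act_pres (e g)
  act_free := by
    filter_upwards [c.act_free] with ω hω g hg
    exact e.map_eq_one_iff.1 (hω _ hg)
  good := c.good
  good_meas := c.good_meas
  good_ae := c.good_ae
  good_act g := c.good_act (e g)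
  pos g := c.pos (e g)
  pos_mul g g' ω := by rw [map_mul, c.pos_mul]
  pos_meas g := c.pos_meas (e g)
  pos_bij ω hω := (c.pos_bij ω hω).comp e.bijective

lemma comapMulEquiv_elt (c : IntCoupling G) (e : Γ ≃* G) (v : ℤ) (ω : c.Ω) :
    (c.comapMulEquiv e).elt v ω = e.symm (c.elt v ω) := by
  by_cases hω : ω ∈ c.good
  · refine (elt_eq_iff (c := c.comapMulEquiv e) hω).2 ?_
    exact (congrArg (fun g => c.pos g ω) (e.apply_symm_apply _)).trans (pos_elt hω v)
  · rw [c.elt_of_notMem hω, map_one]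
    exact (c.comapMulEquiv e).elt_of_notMem hω v

lemma HasTails.comapMulEquiv {c : IntCoupling G} {L : Γ → ℕ} {d : ℕ} {e : Γ ≃* G}
    (h : c.HasTails (fun g => L (e.symm g)) d) : (c.comapMulEquiv e).HasTails L d where
  pos_tail := by
    obtain ⟨C, hC1, hC, hCA⟩ := h.pos_tail
    exact ⟨C, hC1, hC, fun g => hCA (e g)⟩
  elt_tail := by
    obtain ⟨C, hC1, hC, hCv⟩ := h.elt_tail
    refine ⟨C, hC1, hC, fun v k => le_trans (le_of_eq ?_) (hCv v k)⟩
    have : ∀ ω : c.Ω, L ((c.comapMulEquiv e).elt v ω) = L (e.symm (c.elt v ω)) := fun ω =>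
      congrArg L (c.comapMulEquiv_elt e v ω)
    simp_rw [← this]
    rfl

end IntCoupling

/-- Groups of polynomial growth have integer couplings satisfying the tail estimates. -/
lemma exists_intCoupling_hasTails {Γ : Type u} [Group Γ] {S : Set Γ} (hfin : S.Finite)
    (hsymm : S⁻¹ = S) (hone : 1 ∈ S) (hgen : Subgroup.closure S = ⊤) {d : ℕ} (hd : 1 ≤ d)
    (hgrowth : HasPolynomialGrowthDeg S d) :
    ∃ c : IntCoupling Γ, c.HasTails (wordLength S) d := by
  have hS := isLength_wordLength hfin hsymm hone hgen
  have := hS.countable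
  let e : Shrink.{0} Γ ≃* Γ := Shrink.mulEquiv
  have h := hS.comp_mulEquiv e
  have := h.countable
  obtain ⟨C, hC, hCn⟩ := hgrowth
  have hcard : ∀ n, Nat.card {γ : Γ // wordLength S γ ≤ n} = (h.ball n).card := by
    intro n
    have h1 : Nat.card {g : Shrink.{0} Γ // wordLength S (e g) ≤ n} =
        Nat.card {γ : Γ // wordLength S γ ≤ n} :=
      Nat.card_congr (e.toEquiv.subtypeEquiv fun _ => Iff.rfl)
    rw [← h1]
    exact Set.ncard_eq_toFinset_card _ (h.finite n)
  obtain ⟨K, r, hr⟩ := h.exists_isAdapted hC (d := d) fun n hn => by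
    rw [← hcard]
    exact hCn n hn
  exact ⟨_, (hr.intCoupling_hasTails hd).comapMulEquiv (e := e.symm)⟩

/-- infinite finitely generated virtually nilpotent groups `Γ`, `Λ` of
polynomial growth degrees `m`, `n ≥ 1` with `m ≤ n` admit a single orbit equivalence coupling
which is `(L^q, L^q)`-integrable for every `0 < q < m/n`. -/
theorem oe_coupling_of_virtually_nilpotent
    {Γ : Type u} {Λ : Type v} [Group Γ] [Group Λ]
    [Infinite Γ] [Infinite Λ] [Group.FG Γ] [Group.FG Λ]
    (hvnΓ : ∃ N : Subgroup Γ, N.FiniteIndex ∧ Group.IsNilpotent N)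
    (hvnΛ : ∃ N : Subgroup Λ, N.FiniteIndex ∧ Group.IsNilpotent N)
    (SΓ : Set Γ) (hSΓ_fin : SΓ.Finite) (hSΓ_symm : SΓ⁻¹ = SΓ) (hSΓ_one : (1 : Γ) ∈ SΓ)
    (hSΓ_gen : Subgroup.closure SΓ = ⊤)
    (SΛ : Set Λ) (hSΛ_fin : SΛ.Finite) (hSΛ_symm : SΛ⁻¹ = SΛ) (hSΛ_one : (1 : Λ) ∈ SΛ)
    (hSΛ_gen : Subgroup.closure SΛ = ⊤)
    (m n : ℕ) (hm : 1 ≤ m) (hn : 1 ≤ n) (hmn : m ≤ n)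
    (hgrowthΓ : HasPolynomialGrowthDeg SΓ m)
    (hgrowthΛ : HasPolynomialGrowthDeg SΛ n) :
    ∃ c : OrbitEquivalenceCoupling Γ Λ,
      ∀ q : ℝ, 0 < q → q < (m : ℝ) / (n : ℝ) →
        (∀ g : Γ, Integrable (fun x => (wordLength SΛ (c.alpha g x) : ℝ) ^ q) c.μ) ∧
        (∀ h : Λ, Integrable (fun y => (wordLength SΓ (c.beta h y) : ℝ) ^ q) c.ν) := by
  have := (isLength_wordLength hSΓ_fin hSΓ_symm hSΓ_one hSΓ_gen).countable
  have := (isLength_wordLength hSΛ_fin hSΛ_symm hSΛ_one hSΛ_gen).countable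
  obtain ⟨c, hc⟩ := exists_intCoupling_hasTails hSΓ_fin hSΓ_symm hSΓ_one hSΓ_gen hm hgrowthΓ
  obtain ⟨d, hd⟩ := exists_intCoupling_hasTails hSΛ_fin hSΛ_symm hSΛ_one hSΛ_gen hn hgrowthΛ
  exact hc.exists_coupling hd hm hmn
end

section
/- Let G and H be groups, let (X,μ) be a finite measure space on which G acts by measure-preserving measurable bijections, and let α : G × X → H be a map such that α(g,·) is measurable for every g ∈ G and such that for all g₁, g₂ ∈ G and μ-a.e. x ∈ X, α(g₁g₂,x) = α(g₁, g₂·x)·α(g₂,x). Let r be a natural number, C > 1 a constant, ℓ : H → [0,∞) a function, and c : H × H → ℝ a 2-cocycle such that |c(h₁,h₂)| ≤ C(ℓ(h₁)^r + ℓ(h₂)^r) for all h₁, h₂ ∈ H, such that for every g ∈ G the function x ↦ ℓ(α(g,x))^r is μ-integrable, and such that for all g₁, g₂ ∈ G the function x ↦ c(α(g₁,x), α(g₂, g₂^{-1}·x)) is measurable. Then the map c' : G × G → ℝ defined by c'(g₁,g₂) = ∫_X c(α(g₁,x), α(g₂, g₂^{-1}·x)) dμ(x) is well defined (the integrals are finite)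 and is a 2-cocycle on G. -/
open MeasureTheory

/-- Induction of a polynomially bounded 2-cocycle along a measure-equivalence-type
cocycle `α` yields a well-defined 2-cocycle `c'` on `G`, defined by
`c'(g₁,g₂) = ∫_X c(α(g₁,x), α(g₂, g₂⁻¹·x)) dμ(x)`. -/
theorem induced_two_cocycle
    {G H X : Type*} [Group G] [Group H] [MeasurableSpace H] [MeasurableSpace X]
    (μ : Measure X) [IsFiniteMeasure μ]
    (smul : G → X → X)
    (smul_one : ∀ x, smul 1 x = x)
    (smul_mul : ∀ (g₁ g₂ : G) (x : X), smul (g₁ * g₂) x = smul g₁ (smul g₂ x))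
    (smul_meas : ∀ g : G, Measurable (smul g))
    (smul_pres : ∀ g : G, MeasurePreserving (smul g) μ μ)
    (α : G → X → H)
    (α_meas : ∀ g : G, Measurable (α g))
    (α_cocycle : ∀ g₁ g₂ : G, ∀ᵐ x ∂μ, α (g₁ * g₂) x = α g₁ (smul g₂ x) * α g₂ x)
    (r : ℕ) (C : ℝ) (hC : 1 < C)
    (ℓ : H → ℝ) (hℓ : ∀ h : H, 0 ≤ ℓ h)
    (c : H → H → ℝ)
    (c_cocycle : ∀ h₁ h₂ h₃ : H, c h₂ h₃ - c (h₁ * h₂) h₃ + c h₁ (h₂ * h₃) - c h₁ h₂ = 0)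
    (c_bound : ∀ h₁ h₂ : H, |c h₁ h₂| ≤ C * (ℓ h₁ ^ r + ℓ h₂ ^ r))
    (ℓ_int : ∀ g : G, Integrable (fun x => ℓ (α g x) ^ r) μ)
    (c_meas : ∀ g₁ g₂ : G, Measurable (fun x => c (α g₁ x) (α g₂ (smul g₂⁻¹ x)))) :
    (∀ g₁ g₂ : G, Integrable (fun x => c (α g₁ x) (α g₂ (smul g₂⁻¹ x))) μ) ∧
    (∀ g₁ g₂ g₃ : G,
      (∫ x, c (α g₂ x) (α g₃ (smul g₃⁻¹ x)) ∂μ)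
        - (∫ x, c (α (g₁ * g₂) x) (α g₃ (smul g₃⁻¹ x)) ∂μ)
        + (∫ x, c (α g₁ x) (α (g₂ * g₃) (smul (g₂ * g₃)⁻¹ x)) ∂μ)
        - (∫ x, c (α g₁ x) (α g₂ (smul g₂⁻¹ x)) ∂μ) = 0) := by
  have inv_smul (g : G) (x : X) : smul g⁻¹ (smul g x) = x := by
    rw [← smul_mul, inv_mul_cancel, smul_one]
  have smul_inv (g : G) (x : X) : smul g (smul g⁻¹ x) = x := by
    rw [← smul_mul, mul_inv_cancel, smul_one]
  have integrable_c (g₁ g₂ : G) :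
      Integrable (fun x => c (α g₁ x) (α g₂ (smul g₂⁻¹ x))) μ := by
    have h₂ : Integrable (fun x => ℓ (α g₂ (smul g₂⁻¹ x)) ^ r) μ :=
      (smul_pres g₂⁻¹).integrable_comp_of_integrable (ℓ_int g₂)
    refine (((ℓ_int g₁).add h₂).const_mul C).mono' (c_meas g₁ g₂).aestronglyMeasurable ?_
    exact .of_forall fun x => c_bound _ _
  refine ⟨integrable_c, fun g₁ g₂ g₃ => ?_⟩
  have integral_translate (f : X → ℝ) (hf : Integrable f μ) :
      ∫ x, f x ∂μ = ∫ x, f (smul g₂ x) ∂μ := by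
    have hf' := hf.aestronglyMeasurable
    rw [← (smul_pres g₂).map_eq] at hf'
    rw [← integral_map (smul_meas g₂).aemeasurable hf', (smul_pres g₂).map_eq]
  have h₃ := (smul_pres g₂).integrable_comp_of_integrable (integrable_c g₁ (g₂ * g₃))
  have h₄ := (smul_pres g₂).integrable_comp_of_integrable (integrable_c g₁ g₂)
  simp only [Function.comp_def] at h₃ h₄
  rw [integral_translate _ (integrable_c g₁ (g₂ * g₃)),
    integral_translate _ (integrable_c g₁ g₂),
    ← integral_sub' (integrable_c g₂ g₃) (integrable_c (g₁ * g₂) g₃),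
    ← integral_add' ((integrable_c g₂ g₃).sub (integrable_c (g₁ * g₂) g₃)) h₃,
    ← integral_sub' (((integrable_c g₂ g₃).sub (integrable_c (g₁ * g₂) g₃)).add h₃) h₄]
  refine integral_eq_zero_of_ae ?_
  filter_upwards [α_cocycle g₁ g₂,
    (smul_pres g₃⁻¹).quasiMeasurePreserving.ae (α_cocycle g₂ g₃)] with x hx₁ hx₂
  rw [smul_inv] at hx₂
  simpa only [Pi.sub_apply, Pi.add_apply, Pi.zero_apply, mul_inv_rev, smul_mul, inv_smul,
    hx₁, hx₂] using c_cocycle _ _ _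
end

section
/- Let G be a group and let ℓ : G → [0,∞) be a function with ℓ(g^{-1}) = ℓ(g) and ℓ(gh) ≤ ℓ(g) + ℓ(h) for all g, h ∈ G. Let s ≥ 2 be an integer, C > 0, and let c : G × G → ℝ be a 2-cocycle satisfying |c(g₁,g₂)| ≤ C(ℓ(g₁)^{s−1}ℓ(g₂) + ℓ(g₁)ℓ(g₂)^{s−1}) for all g₁, g₂ ∈ G. Then there is C' > 0, depending only on C and s, such that for all R > 0, all ε ∈ (0,1], and all u, v, ū, v̄ ∈ G with ℓ(u), ℓ(v), ℓ(ū), ℓ(v̄) < R, ℓ(u·ū^{-1}) < εR and ℓ(v·v̄^{-1}) < εR, one has |c(u, v^{-1}) − c(ū, v̄^{-1})| ≤ ε·C'·R^s. -/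
universe u

/-- If one of the two arguments has size at most `ε * R` and the other at most `2 * R`, then the
symmetric polynomial expression of degree `n + 2` is linear in `ε`. -/
theorem pow_mul_add_mul_pow_le_of_le {n : ℕ} {R ε a x : ℝ} (hR : 0 < R) (hε : 0 < ε)
    (hε1 : ε ≤ 1) (ha0 : 0 ≤ a) (hx0 : 0 ≤ x) (ha : a ≤ ε * R) (hx : x ≤ 2 * R) :
    a ^ (n + 1) * x + a * x ^ (n + 1) ≤ ε * (2 * 2 ^ (n + 2)) * R ^ (n + 2) := by
  have hpow : ε ^ (n + 1) ≤ ε := pow_le_of_le_one hε.le hε1 n.succ_ne_zero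
  have h2 : (1 : ℝ) ≤ 2 ^ n := one_le_pow₀ one_le_two
  have hεR : 0 ≤ ε * R ^ (n + 2) := by positivity
  calc a ^ (n + 1) * x + a * x ^ (n + 1)
      ≤ (ε * R) ^ (n + 1) * (2 * R) + (ε * R) * (2 * R) ^ (n + 1) := by gcongr
    _ = ε ^ (n + 1) * (2 * R ^ (n + 2)) + 2 * 2 ^ n * (ε * R ^ (n + 2)) := by
        rw [mul_pow, mul_pow]; ring
    _ ≤ ε * (2 * R ^ (n + 2)) + 2 * 2 ^ n * (ε * R ^ (n + 2)) := by gcongr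
    _ ≤ ε * (2 * 2 ^ (n + 2)) * R ^ (n + 2) := by
        have := mul_le_mul_of_nonneg_right h2 hεR
        rw [pow_add 2 n 2]
        linarith

/-- continuity estimate for polynomially bounded 2-cocycles with respect to a
subadditive, symmetric length function: there is a constant `C'` depending only on `C` and `s`
such that `|c(u,v⁻¹) − c(ū,v̄⁻¹)| ≤ ε·C'·R^s` whenever the lengths of `u,v,ū,v̄` are `< R` and
`ℓ(u·ū⁻¹), ℓ(v·v̄⁻¹) < εR`. -/
theorem cocycle_extends_to_cone (s : ℕ) (hs : 2 ≤ s) (C : ℝ) (hC : 0 < C) :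
    ∃ C' : ℝ, 0 < C' ∧
      ∀ (G : Type u) [Group G], ∀ ℓ : G → ℝ,
        (∀ g : G, 0 ≤ ℓ g) →
        (∀ g : G, ℓ g⁻¹ = ℓ g) →
        (∀ g h : G, ℓ (g * h) ≤ ℓ g + ℓ h) →
        ∀ c : G → G → ℝ,
          (∀ g₁ g₂ g₃ : G, c g₂ g₃ - c (g₁ * g₂) g₃ + c g₁ (g₂ * g₃) - c g₁ g₂ = 0) →
          (∀ g₁ g₂ : G, |c g₁ g₂| ≤ C * (ℓ g₁ ^ (s - 1) * ℓ g₂ + ℓ g₁ * ℓ g₂ ^ (s - 1))) →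
          ∀ R : ℝ, 0 < R → ∀ ε : ℝ, 0 < ε → ε ≤ 1 →
            ∀ u v ubar vbar : G,
              ℓ u < R → ℓ v < R → ℓ ubar < R → ℓ vbar < R →
              ℓ (u * ubar⁻¹) < ε * R → ℓ (v * vbar⁻¹) < ε * R →
              |c u v⁻¹ - c ubar vbar⁻¹| ≤ ε * C' * R ^ s := by
  obtain ⟨n, rfl⟩ := Nat.exists_eq_add_of_le' hs
  refine ⟨4 * (C * (2 * 2 ^ (n + 2))), by positivity, ?_⟩
  intro G _ ℓ hℓ0 hinv hmul c hc hbound R hR ε hε hε1 u v ubar vbar hu hv hubar hvbar huu hvv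
  rw [show n + 2 - 1 = n + 1 by omega] at hbound
  have hleft (a x : G) (ha : ℓ a ≤ ε * R) (hx : ℓ x ≤ 2 * R) :
      |c a x| ≤ C * (ε * (2 * 2 ^ (n + 2)) * R ^ (n + 2)) :=
    (hbound a x).trans <| mul_le_mul_of_nonneg_left
      (pow_mul_add_mul_pow_le_of_le hR hε hε1 (hℓ0 a) (hℓ0 x) ha hx) hC.le
  have hright (x a : G) (ha : ℓ a ≤ ε * R) (hx : ℓ x ≤ 2 * R) :
      |c x a| ≤ C * (ε * (2 * 2 ^ (n + 2)) * R ^ (n + 2)) := by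
    refine (hbound x a).trans <| mul_le_mul_of_nonneg_left ?_ hC.le
    have := pow_mul_add_mul_pow_le_of_le (n := n) hR hε hε1 (hℓ0 a) (hℓ0 x) ha hx
    linarith
  have hvv' : ℓ (v * vbar⁻¹)⁻¹ ≤ ε * R := (hinv _).trans_le hvv.le
  have hv' := hinv v
  have hvbar' := hinv vbar
  have huv := hmul ubar v⁻¹
  have huvbar := hmul ubar vbar⁻¹
  have h₁ := abs_le.1 (hleft (u * ubar⁻¹) (ubar * v⁻¹) huu.le (by linarith))
  have h₂ := abs_le.1 (hleft (u * ubar⁻¹) ubar huu.le (by linarith))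
  have h₃ := abs_le.1 (hright vbar⁻¹ (v * vbar⁻¹)⁻¹ hvv' (by linarith))
  have h₄ := abs_le.1 (hright (ubar * vbar⁻¹) (v * vbar⁻¹)⁻¹ hvv' (by linarith))
  have e₁ := hc (u * ubar⁻¹) ubar v⁻¹
  have e₂ := hc ubar vbar⁻¹ (v * vbar⁻¹)⁻¹
  rw [inv_mul_cancel_right] at e₁
  rw [show vbar⁻¹ * (v * vbar⁻¹)⁻¹ = v⁻¹ by group] at e₂
  rw [abs_le]
  constructor <;> linarith [h₁.1, h₁.2, h₂.1, h₂.2, h₃.1, h₃.2, h₄.1, h₄.2]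
end

section
/- Let 𝔤 be a finite-dimensional real nilpotent Lie algebra with γ_{s+1}(𝔤) = 0 for some s ≥ 1, equipped with a norm ‖·‖ and with fixed linear subspaces A_1, …, A_s such that γ_i(𝔤) = A_i ⊕ γ_{i+1}(𝔤) for every 1 ≤ i ≤ s. Then there exists C ≥ 1 such that for all 1 ≤ i, j ≤ s and all u ∈ A_i, v ∈ A_j one has |[u,v]|^{i+j} ≤ C·|u|^i·|v|^j, where |·| denotes the Guivarc'h gauge. -/
open scoped BigOperators

/-- The Guivarc'h gauge `|x| := 1 + Σ_{i=1}^{s} ‖x_i‖^{1/i}`, where `x = Σ_i x_i` with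
`x_i = π i x` the component of `x` in the subspace `A_i`, and `N` is the chosen norm. -/
noncomputable def guivarchGauge {L : Type*} [LieRing L] [LieAlgebra ℝ L]
    (N : L → ℝ) (π : ℕ → L →ₗ[ℝ] L) (s : ℕ) (x : L) : ℝ :=
  1 + ∑ i ∈ Finset.Icc 1 s, (N (π i x)) ^ ((1 : ℝ) / (i : ℝ))

open LieModule in
/-- `[γ_{p+1}(L), γ_{q+1}(M)] ⊆ γ_{p+q+2}(M)`. -/
theorem lie_mem_lowerCentralSeries_add {R L M : Type*} [CommRing R] [LieRing L] [LieAlgebra R L]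
    [AddCommGroup M] [Module R M] [LieRingModule L M] [LieModule R L M] {p q : ℕ} {x : L} {m : M}
    (hx : x ∈ lowerCentralSeries R L L p) (hm : m ∈ lowerCentralSeries R L M q) :
    ⁅x, m⁆ ∈ lowerCentralSeries R L M (p + q + 1) := by
  induction p generalizing q x m with
  | zero =>
    rw [zero_add, lowerCentralSeries_succ]
    exact LieSubmodule.lie_mem_lie (LieSubmodule.mem_top x) hm
  | succ p ih =>
    rw [lowerCentralSeries_succ, ← LieSubmodule.mem_toSubmodule,
      LieSubmodule.lieIdeal_oper_eq_linear_span'] at hx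
    induction hx using Submodule.span_induction with
    | mem x hx =>
      obtain ⟨y, -, z, hz, rfl⟩ := hx
      rw [lie_lie]
      refine sub_mem ?_ ?_
      · rw [show p + 1 + q + 1 = (p + q + 1) + 1 by ring, lowerCentralSeries_succ]
        exact LieSubmodule.lie_mem_lie (LieSubmodule.mem_top y) (ih hz hm)
      · have hym : ⁅y, m⁆ ∈ lowerCentralSeries R L M (q + 1) := by
          rw [lowerCentralSeries_succ]
          exact LieSubmodule.lie_mem_lie (LieSubmodule.mem_top y) hm
        rw [show p + 1 + q + 1 = p + (q + 1) + 1 by ring]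
        exact ih hz hym
    | zero => rw [zero_lie]; exact zero_mem _
    | add x y _ _ hx hy => rw [add_lie]; exact add_mem hx hy
    | smul r x _ hx => rw [smul_lie]; exact (lowerCentralSeries R L M _).smul_mem r hx

/-- A bilinear map on a finite-dimensional real vector space is bounded with respect to any
norm. -/
theorem LinearMap.exists_bilinear_bound_of_norm {E : Type*} [AddCommGroup E] [Module ℝ E]
    [FiniteDimensional ℝ E] {N : E → ℝ} (hN_nonneg : ∀ x, 0 ≤ N x)
    (hN_eq_zero : ∀ x, N x = 0 ↔ x = 0) (hN_add : ∀ x y, N (x + y) ≤ N x + N y)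
    (hN_smul : ∀ (r : ℝ) (x : E), N (r • x) = |r| * N x) (B : E →ₗ[ℝ] E →ₗ[ℝ] E) :
    ∃ K : ℝ, ∀ u v, N (B u v) ≤ K * N u * N v := by
  let _ : Norm E := ⟨N⟩
  have core : NormedSpace.Core ℝ E :=
    { norm_nonneg := hN_nonneg
      norm_smul := hN_smul
      norm_triangle := hN_add
      norm_eq_zero_iff := hN_eq_zero }
  let _ : NormedAddCommGroup E := NormedAddCommGroup.ofCore core
  let _ : NormedSpace ℝ E := NormedSpace.ofCore core
  exact ⟨‖B.toContinuousBilinearMap‖, fun u v => B.toContinuousBilinearMap.le_opNorm₂ u v⟩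

/-- If `F i = A i ⊕ F (i + 1)` for a decreasing filtration `F`, a sum of elements of the `A i`
lying in `F m` has no component of index below `m`. -/
theorem Submodule.eq_zero_of_sum_mem_filtration {R E : Type*} [Ring R] [AddCommGroup E]
    [Module R E] {s m : ℕ} {A F : ℕ → Submodule R E} (hF : Antitone F)
    (hAF : ∀ i, 1 ≤ i → i ≤ s → A i ≤ F i)
    (hdisj : ∀ i, 1 ≤ i → i ≤ s → Disjoint (A i) (F (i + 1)))
    {f : ℕ → E} (hf : ∀ i, f i ∈ A i) (hsum : ∑ i ∈ Finset.Icc 1 s, f i ∈ F m)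
    {k : ℕ} (hk : 1 ≤ k) (hks : k ≤ s) (hkm : k < m) : f k = 0 := by
  induction k using Nat.strong_induction_on with
  | _ k ih =>
  have hmem : k ∈ Finset.Icc 1 s := Finset.mem_Icc.2 ⟨hk, hks⟩
  have hrest : ∑ i ∈ (Finset.Icc 1 s).erase k, f i ∈ F (k + 1) := by
    refine Submodule.sum_mem _ fun i hi => ?_
    obtain ⟨hik, hi⟩ := Finset.mem_erase.1 hi
    obtain ⟨hi1, his⟩ := Finset.mem_Icc.1 hi
    rcases lt_or_gt_of_ne hik with h | h
    · rw [ih i h hi1 his (h.trans hkm)]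
      exact zero_mem _
    · exact hF h (hAF i hi1 his (hf i))
  refine Submodule.disjoint_def.1 (hdisj k hk hks) _ (hf k) ?_
  rw [← Finset.add_sum_erase _ _ hmem] at hsum
  exact (Submodule.add_mem_iff_left _ hrest).1 (hF hkm hsum)

/-- If all components of `x` have norm at most `K * M` and those of degree below `n` vanish,
then the gauge of `x` satisfies `|x| ^ n ≤ (1 + s * K) ^ n * M`. -/
theorem guivarchGauge_pow_le {L : Type*} [LieRing L] [LieAlgebra ℝ L] {N : L → ℝ}
    (hN_nonneg : ∀ x, 0 ≤ N x) (hN_zero : N 0 = 0) {π : ℕ → L →ₗ[ℝ] L} {s n : ℕ} (hn : n ≠ 0)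
    {K M : ℝ} (hK : 1 ≤ K) (hM : 1 ≤ M) {x : L}
    (hlow : ∀ k ∈ Finset.Icc 1 s, k < n → π k x = 0)
    (hhigh : ∀ k ∈ Finset.Icc 1 s, N (π k x) ≤ K * M) :
    guivarchGauge N π s x ^ n ≤ (1 + s * K) ^ n * M := by
  have hM0 : (0 : ℝ) ≤ M := zero_le_one.trans hM
  have hK0 : (0 : ℝ) ≤ K := zero_le_one.trans hK
  have hroot : (1 : ℝ) ≤ M ^ ((1 : ℝ) / n) := Real.one_le_rpow hM (by positivity)
  have hterm : ∀ k ∈ Finset.Icc 1 s, N (π k x) ^ ((1 : ℝ) / k) ≤ K * M ^ ((1 : ℝ) / n) := by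
    intro k hk
    have hk1 : (1 : ℝ) ≤ k := by exact_mod_cast (Finset.mem_Icc.1 hk).1
    rcases lt_or_ge k n with hkn | hkn
    · rw [hlow k hk hkn, hN_zero, Real.zero_rpow (by positivity)]
      positivity
    · calc N (π k x) ^ ((1 : ℝ) / k) ≤ (K * M) ^ ((1 : ℝ) / k) :=
            Real.rpow_le_rpow (hN_nonneg _) (hhigh k hk) (by positivity)
        _ = K ^ ((1 : ℝ) / k) * M ^ ((1 : ℝ) / k) := Real.mul_rpow hK0 hM0
        _ ≤ K * M ^ ((1 : ℝ) / n) := by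
          gcongr
          · exact (Real.rpow_le_rpow_of_exponent_le hK
              ((div_le_one (by positivity)).2 hk1)).trans_eq (Real.rpow_one K)
  have hgauge : guivarchGauge N π s x ≤ (1 + s * K) * M ^ ((1 : ℝ) / n) := by
    have hsum := Finset.sum_le_sum hterm
    rw [Finset.sum_const, Nat.card_Icc, Nat.add_sub_cancel, nsmul_eq_mul] at hsum
    unfold guivarchGauge
    linarith
  have hgauge0 : 0 ≤ guivarchGauge N π s x :=
    add_nonneg zero_le_one (Finset.sum_nonneg fun _ _ => Real.rpow_nonneg (hN_nonneg _) _)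
  calc guivarchGauge N π s x ^ n ≤ ((1 + s * K) * M ^ ((1 : ℝ) / n)) ^ n := by gcongr
    _ = (1 + s * K) ^ n * M := by
      rw [mul_pow, one_div, Real.rpow_inv_natCast_pow hM0 hn]

/-- A component of `x` of degree `i` is dominated by the `i`-th power of the gauge of `x`. -/
theorem norm_component_le_guivarchGauge_pow {L : Type*} [LieRing L] [LieAlgebra ℝ L] {N : L → ℝ}
    (hN_nonneg : ∀ x, 0 ≤ N x) (π : ℕ → L →ₗ[ℝ] L) {s i : ℕ} (hi : 1 ≤ i) (his : i ≤ s) (x : L) :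
    N (π i x) ≤ guivarchGauge N π s x ^ i := by
  have hterm : N (π i x) ^ ((1 : ℝ) / i) ≤ guivarchGauge N π s x :=
    (Finset.single_le_sum (f := fun k : ℕ => N (π k x) ^ ((1 : ℝ) / k))
      (fun _ _ => Real.rpow_nonneg (hN_nonneg _) _) (Finset.mem_Icc.2 ⟨hi, his⟩)).trans
      (le_add_of_nonneg_left zero_le_one)
  calc N (π i x) = (N (π i x) ^ ((1 : ℝ) / i)) ^ i := by
        rw [one_div, Real.rpow_inv_natCast_pow (hN_nonneg _) (by lia)]
    _ ≤ guivarchGauge N π s x ^ i :=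
        pow_le_pow_left₀ (Real.rpow_nonneg (hN_nonneg _) _) hterm i

/-- The gauge is at least `1`. -/
theorem one_le_guivarchGauge {L : Type*} [LieRing L] [LieAlgebra ℝ L] {N : L → ℝ}
    (hN_nonneg : ∀ x, 0 ≤ N x) (π : ℕ → L →ₗ[ℝ] L) (s : ℕ) (x : L) :
    1 ≤ guivarchGauge N π s x :=
  le_add_of_nonneg_right (Finset.sum_nonneg fun _ _ => Real.rpow_nonneg (hN_nonneg _) _)

/-- In a finite-dimensional real nilpotent Lie algebra `𝔤` with `γ_{s+1}(𝔤) = 0`,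
fixed complements `A_i` of `γ_{i+1}(𝔤)` inside `γ_i(𝔤)` and the associated Guivarc'h gauge,
there is `C ≥ 1` with `|[u,v]|^{i+j} ≤ C·|u|^i·|v|^j` for all `u ∈ A_i`, `v ∈ A_j`.
Here `γ_i(𝔤)` is `LieModule.lowerCentralSeries ℝ 𝔤 𝔤 (i-1)`. -/
theorem guivarch_gauge_bracket_bound
    {L : Type*} [LieRing L] [LieAlgebra ℝ L] [FiniteDimensional ℝ L]
    (s : ℕ) (hs : 1 ≤ s)
    (hnil : LieModule.lowerCentralSeries ℝ L L s = ⊥)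
    (A : ℕ → Submodule ℝ L)
    (hA_sup : ∀ i, 1 ≤ i → i ≤ s →
      A i ⊔ LieSubmodule.toSubmodule (LieModule.lowerCentralSeries ℝ L L i)
        = LieSubmodule.toSubmodule (LieModule.lowerCentralSeries ℝ L L (i - 1)))
    (hA_disj : ∀ i, 1 ≤ i → i ≤ s →
      Disjoint (A i) (LieSubmodule.toSubmodule (LieModule.lowerCentralSeries ℝ L L i)))
    (N : L → ℝ)
    (hN_nonneg : ∀ x, 0 ≤ N x)
    (hN_eq_zero : ∀ x, N x = 0 ↔ x = 0)
    (hN_add : ∀ x y, N (x + y) ≤ N x + N y)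
    (hN_smul : ∀ (r : ℝ) (x : L), N (r • x) = |r| * N x)
    (π : ℕ → L →ₗ[ℝ] L)
    (hπ_mem : ∀ i x, π i x ∈ A i)
    (hπ_sum : ∀ x : L, ∑ i ∈ Finset.Icc 1 s, π i x = x) :
    ∃ C : ℝ, 1 ≤ C ∧ ∀ i j : ℕ, 1 ≤ i → i ≤ s → 1 ≤ j → j ≤ s →
      ∀ u ∈ A i, ∀ v ∈ A j,
        guivarchGauge N π s ⁅u, v⁆ ^ (i + j)
          ≤ C * guivarchGauge N π s u ^ i * guivarchGauge N π s v ^ j := by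
  let F : ℕ → Submodule ℝ L := fun i =>
    LieSubmodule.toSubmodule (LieModule.lowerCentralSeries ℝ L L (i - 1))
  have hF : Antitone F := fun i j hij =>
    LieModule.antitone_lowerCentralSeries ℝ L L (Nat.sub_le_sub_right hij 1)
  have hAF : ∀ i, 1 ≤ i → i ≤ s → A i ≤ F i := fun i hi his =>
    le_sup_left.trans (hA_sup i hi his).le
  have hlow : ∀ m x, x ∈ F m → ∀ k ∈ Finset.Icc 1 s, k < m → π k x = 0 := by
    intro m x hx k hk hkm
    exact Submodule.eq_zero_of_sum_mem_filtration hF hAF hA_disj (fun i => hπ_mem i x)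
      ((hπ_sum x).symm ▸ hx) (Finset.mem_Icc.1 hk).1 (Finset.mem_Icc.1 hk).2 hkm
  have hproj : ∀ i, 1 ≤ i → i ≤ s → ∀ u ∈ A i, π i u = u := by
    intro i hi his u hu
    have hmem : ∀ k, π k u - Pi.single (M := fun _ => L) i u k ∈ A k := by
      intro k
      refine sub_mem (hπ_mem k u) ?_
      rcases eq_or_ne k i with rfl | h
      · simpa using hu
      · simp [h]
    have hsum : ∑ k ∈ Finset.Icc 1 s, (π k u - Pi.single (M := fun _ => L) i u k) = 0 := by
      rw [Finset.sum_sub_distrib, hπ_sum, Finset.sum_pi_single',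
        if_pos (Finset.mem_Icc.2 ⟨hi, his⟩), sub_self]
    have h := Submodule.eq_zero_of_sum_mem_filtration (m := s + 1) hF hAF hA_disj hmem
      (hsum ▸ zero_mem _) hi his (Nat.lt_succ_of_le his)
    simpa [sub_eq_zero] using h
  choose K hK using fun k => LinearMap.exists_bilinear_bound_of_norm hN_nonneg hN_eq_zero hN_add
    hN_smul ((LieModule.toEnd ℝ L L : L →ₗ[ℝ] Module.End ℝ L).compr₂ (π k))
  let K₀ : ℝ := 1 + ∑ k ∈ Finset.Icc 1 s, |K k|
  have hK₀ : 1 ≤ K₀ := le_add_of_nonneg_right (Finset.sum_nonneg fun _ _ => abs_nonneg _)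
  have hKK₀ : ∀ k ∈ Finset.Icc 1 s, K k ≤ K₀ := fun k hk =>
    (le_abs_self _).trans ((Finset.single_le_sum (f := fun k => |K k|)
      (fun _ _ => abs_nonneg _) hk).trans (le_add_of_nonneg_left zero_le_one))
  have hbase : 1 ≤ 1 + s * K₀ := le_add_of_nonneg_right (by positivity)
  refine ⟨(1 + s * K₀) ^ (2 * s), one_le_pow₀ hbase, fun i j hi his hj hjs u hu v hv => ?_⟩
  have hu_le : N u ≤ guivarchGauge N π s u ^ i := by
    simpa only [hproj i hi his u hu] using
      norm_component_le_guivarchGauge_pow hN_nonneg π hi his u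
  have hv_le : N v ≤ guivarchGauge N π s v ^ j := by
    simpa only [hproj j hj hjs v hv] using
      norm_component_le_guivarchGauge_pow hN_nonneg π hj hjs v
  have hu_one : 1 ≤ guivarchGauge N π s u ^ i := one_le_pow₀ (one_le_guivarchGauge hN_nonneg π s u)
  have hv_one : 1 ≤ guivarchGauge N π s v ^ j := one_le_pow₀ (one_le_guivarchGauge hN_nonneg π s v)
  have huv : ⁅u, v⁆ ∈ F (i + j) := by
    have h := lie_mem_lowerCentralSeries_add (hAF i hi his hu) (hAF j hj hjs hv)
    rwa [show i - 1 + (j - 1) + 1 = i + j - 1 by lia] at h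
  have hhigh : ∀ k ∈ Finset.Icc 1 s, N (π k ⁅u, v⁆) ≤
      K₀ * (guivarchGauge N π s u ^ i * guivarchGauge N π s v ^ j) := by
    intro k hk
    have hNu := hN_nonneg u
    have hNv := hN_nonneg v
    calc N (π k ⁅u, v⁆) ≤ K k * N u * N v := hK k u v
      _ ≤ K₀ * N u * N v := by gcongr; exact hKK₀ k hk
      _ = K₀ * (N u * N v) := mul_assoc _ _ _
      _ ≤ _ := by gcongr
  refine (guivarchGauge_pow_le hN_nonneg ((hN_eq_zero 0).2 rfl) (by lia) hK₀
    (one_le_mul_of_one_le_of_one_le hu_one hv_one) (hlow _ _ huv) hhigh).trans ?_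
  rw [mul_assoc]
  gcongr
  lia
end

section
/- Fix an integer i ≥ 1 and an even integer k ≥ 0, and let D_{i,k} be the set of tuples (δ_0, δ_1, …, δ_k) such that δ_0 is a real number in the interval (−2^{i−1}, 2^{i−1}], δ_ℓ is an integer in {−2^i, …, −1} for every odd ℓ with 1 ≤ ℓ ≤ k, and δ_ℓ is an integer in {0, …, 2^i − 1} for every even ℓ with 2 ≤ ℓ ≤ k. Then: (a) the map sending (δ_0, …, δ_k) to Σ_{ℓ=0}^{k} δ_ℓ·2^{ℓ·i} is injective on D_{i,k} and its image is a half-open interval of the form (L, L + 2^{(k+1)i}] for some real L; (b) for every real number λ there is an even k₀ such that λ lies in this image for every even k ≥ k₀; (c) if λ lies in the image for an even k and k' ≥ k is even, then the unique tuples in D_{i,k} and D_{i,k'} representing λ agree in coordinates 0, 1, …, k. -/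
/-- The set of digit tuples `(δ_0, …, δ_k)` for a fixed `i ≥ 1`: `δ_0` is a real number in
`(−2^{i−1}, 2^{i−1}]`, `δ_ℓ` is an integer in `{−2^i, …, −1}` for odd `1 ≤ ℓ ≤ k` and an
integer in `{0, …, 2^i − 1}` for even `2 ≤ ℓ ≤ k`. -/
def digitSet (i k : ℕ) : Set (Fin (k + 1) → ℝ) :=
  {δ | δ 0 ∈ Set.Ioc (-(2 : ℝ) ^ (i - 1)) ((2 : ℝ) ^ (i - 1)) ∧
    (∀ ℓ : Fin (k + 1), Odd ℓ.val →
      ∃ m : ℤ, -(2 : ℤ) ^ i ≤ m ∧ m ≤ -1 ∧ δ ℓ = (m : ℝ)) ∧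
    (∀ ℓ : Fin (k + 1), ℓ.val ≠ 0 → Even ℓ.val →
      ∃ m : ℤ, 0 ≤ m ∧ m ≤ 2 ^ i - 1 ∧ δ ℓ = (m : ℝ))}

/-- The value represented by a digit tuple: `Σ_{ℓ=0}^{k} δ_ℓ · 2^{ℓ·i}`. -/
def digitVal (i k : ℕ) (δ : Fin (k + 1) → ℝ) : ℝ :=
  ∑ ℓ : Fin (k + 1), δ ℓ * 2 ^ (ℓ.val * i)

/-- The least admissible integer digit at a position `ℓ ≥ 1`. -/
def minDigit (i ℓ : ℕ) : ℤ := if Odd ℓ then -2 ^ i else 0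

/-- The left endpoint of the interval of represented values. -/
noncomputable def leftEnd (i : ℕ) : ℕ → ℝ
  | 0 => -(2 : ℝ) ^ (i - 1)
  | k + 1 => leftEnd i k + minDigit i (k + 1) * 2 ^ ((k + 1) * i)

theorem mem_digitSet_succ (i k : ℕ) (δ : Fin (k + 1 + 1) → ℝ) :
    δ ∈ digitSet i (k + 1) ↔ Fin.init (α := fun _ => ℝ) δ ∈ digitSet i k ∧
      ∃ m : ℤ, minDigit i (k + 1) ≤ m ∧ m < minDigit i (k + 1) + 2 ^ i ∧
        δ (Fin.last (k + 1)) = m := by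
  simp only [digitSet, Set.mem_ofPred_eq, Fin.forall_fin_succ' (n := k + 1), Fin.init,
    Fin.val_castSucc, Fin.val_last, Fin.castSucc_zero, minDigit]
  rcases Nat.even_or_odd (k + 1) with h | h
  · have h' : ¬ Odd (k + 1) := Nat.not_odd_iff_even.2 h
    simp only [h, h', if_false, ne_eq, Nat.add_eq_zero_iff, one_ne_zero, and_false,
      not_false_eq_true, forall_true_left, false_imp_iff, and_true, zero_add,
      Int.le_sub_one_iff, and_assoc]
  · have h' : ¬ Even (k + 1) := Nat.not_even_iff_odd.2 h
    simp only [h, h', if_true, forall_true_left, false_imp_iff, implies_true, and_true,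
      neg_add_cancel, show ∀ m : ℤ, m ≤ -1 ↔ m < 0 from fun m => by omega]
    tauto

theorem digitVal_succ (i k : ℕ) (δ : Fin (k + 1 + 1) → ℝ) :
    digitVal i (k + 1) δ = digitVal i k (Fin.init (α := fun _ => ℝ) δ) +
      δ (Fin.last (k + 1)) * 2 ^ ((k + 1) * i) := by
  simp only [digitVal, Fin.sum_univ_castSucc (n := k + 1), Fin.init, Fin.val_castSucc,
    Fin.val_last]

theorem int_eq_of_add_mul_eq {L W x y : ℝ} {m n : ℤ} (hx : x ∈ Set.Ioc L (L + W))
    (hy : y ∈ Set.Ioc L (L + W)) (h : x + m * W = y + n * W) : m = n := by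
  obtain ⟨hx1, hx2⟩ := hx
  obtain ⟨hy1, hy2⟩ := hy
  have hW : 0 < W := by linarith
  have h1 : (m : ℝ) < n + 1 := by
    by_contra! hc
    nlinarith [mul_le_mul_of_nonneg_right hc hW.le]
  have h2 : (n : ℝ) < m + 1 := by
    by_contra! hc
    nlinarith [mul_le_mul_of_nonneg_right hc hW.le]
  norm_cast at h1 h2
  omega

theorem exists_add_mul_eq_iff {L W y : ℝ} (hW : 0 < W) (a b : ℤ) :
    (∃ x ∈ Set.Ioc L (L + W), ∃ m : ℤ, a ≤ m ∧ m < a + b ∧ x + m * W = y) ↔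
      y ∈ Set.Ioc (L + a * W) (L + a * W + b * W) := by
  constructor
  · rintro ⟨x, ⟨hx1, hx2⟩, m, hm1, hm2, rfl⟩
    have h1 : (a : ℝ) ≤ m := by exact_mod_cast hm1
    have h2 : (m : ℝ) + 1 ≤ a + b := by exact_mod_cast hm2
    have h3 := mul_le_mul_of_nonneg_right h1 hW.le
    have h4 := mul_le_mul_of_nonneg_right h2 hW.le
    constructor <;> linarith
  · rintro ⟨h1, h2⟩
    obtain ⟨m, ⟨hm1, hm2⟩, -⟩ := existsUnique_sub_zsmul_mem_Ioc hW y L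
    rw [zsmul_eq_mul] at hm1 hm2
    refine ⟨y - m * W, ⟨hm1, hm2⟩, m, ?_, ?_, by ring⟩
    · have : (a : ℝ) < m + 1 := lt_of_mul_lt_mul_right (by linarith) hW.le
      exact Int.lt_add_one_iff.1 (by exact_mod_cast this)
    · have : (m : ℝ) < a + b := lt_of_mul_lt_mul_right (by linarith) hW.le
      exact_mod_cast this

theorem image_digitVal {i : ℕ} (hi : 1 ≤ i) (k : ℕ) :
    digitVal i k '' digitSet i k =
      Set.Ioc (leftEnd i k) (leftEnd i k + 2 ^ ((k + 1) * i)) := by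
  induction k with
  | zero =>
    have h2 : -(2 : ℝ) ^ (i - 1) + 2 ^ i = 2 ^ (i - 1) := by
      obtain ⟨j, rfl⟩ := Nat.exists_eq_add_of_le' hi
      rw [Nat.add_sub_cancel]
      ring
    ext y
    simp only [leftEnd, zero_add, one_mul, h2]
    constructor
    · rintro ⟨δ, hδ, rfl⟩
      simpa [digitVal] using hδ.1
    · intro hy
      exact ⟨fun _ => y, ⟨hy, by simp, by simp⟩, by simp [digitVal]⟩
  | succ k ih =>
    ext y
    have key := exists_add_mul_eq_iff (L := leftEnd i k) (W := 2 ^ ((k + 1) * i)) (y := y)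
      (by positivity) (minDigit i (k + 1)) (2 ^ i)
    have hpow : ((2 ^ i : ℤ) : ℝ) * 2 ^ ((k + 1) * i) = 2 ^ ((k + 1 + 1) * i) := by
      push_cast
      ring
    rw [hpow] at key
    rw [leftEnd, ← key, ← ih]
    constructor
    · rintro ⟨δ, hδ, rfl⟩
      obtain ⟨h, m, hm1, hm2, hm⟩ := (mem_digitSet_succ i k δ).1 hδ
      exact ⟨_, ⟨_, h, rfl⟩, m, hm1, hm2, by rw [digitVal_succ, hm]⟩
    · rintro ⟨_, ⟨δ, hδ, rfl⟩, m, hm1, hm2, rfl⟩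
      refine ⟨Fin.snoc (α := fun _ => ℝ) δ (m : ℝ), ?_, ?_⟩
      · rw [mem_digitSet_succ, Fin.init_snoc, Fin.snoc_last]
        exact ⟨hδ, m, hm1, hm2, rfl⟩
      · rw [digitVal_succ, Fin.init_snoc, Fin.snoc_last]

theorem injOn_digitVal {i : ℕ} (hi : 1 ≤ i) (k : ℕ) :
    Set.InjOn (digitVal i k) (digitSet i k) := by
  induction k with
  | zero =>
    intro δ _ δ' _ h
    funext ℓ
    rw [Fin.fin_one_eq_zero ℓ]
    simpa [digitVal] using h
  | succ k ih =>
    intro δ hδ δ' hδ' h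
    obtain ⟨h1, m, -, -, hm⟩ := (mem_digitSet_succ i k δ).1 hδ
    obtain ⟨h1', m', -, -, hm'⟩ := (mem_digitSet_succ i k δ').1 hδ'
    rw [digitVal_succ, digitVal_succ, hm, hm'] at h
    have hmm : m = m' := int_eq_of_add_mul_eq
      (image_digitVal hi k ▸ Set.mem_image_of_mem _ h1)
      (image_digitVal hi k ▸ Set.mem_image_of_mem _ h1') h
    subst hmm
    rw [← Fin.snoc_init_self (α := fun _ => ℝ) δ, ← Fin.snoc_init_self (α := fun _ => ℝ) δ',
      ih h1 h1' (add_right_cancel h), hm, hm']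

theorem exists_extend_add_two {i k : ℕ} (hi : 1 ≤ i) (hk : Even k) {δ : Fin (k + 1) → ℝ}
    (hδ : δ ∈ digitSet i k) :
    ∃ δ' ∈ digitSet i (k + 2), digitVal i (k + 2) δ' = digitVal i k δ ∧
      ∀ ℓ : Fin (k + 1), δ' ℓ.castSucc.castSucc = δ ℓ := by
  have h1 : Odd (k + 1) := hk.add_one
  have h2 : ¬ Odd (k + 1 + 1) := Nat.not_odd_iff_even.2 h1.add_one
  have hpow : (1 : ℤ) < 2 ^ i := one_lt_pow₀ (by norm_num) (by omega)
  refine ⟨Fin.snoc (α := fun _ => ℝ)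
    (Fin.snoc (α := fun _ => ℝ) δ ((-2 ^ i : ℤ) : ℝ)) ((1 : ℤ) : ℝ), ?_, ?_, ?_⟩
  · rw [mem_digitSet_succ, mem_digitSet_succ]
    simp only [Fin.init_snoc, Fin.snoc_last, minDigit, h1, h2, if_true, if_false]
    exact ⟨⟨hδ, _, le_rfl, by omega, rfl⟩, 1, by omega, by omega, rfl⟩
  · rw [digitVal_succ, digitVal_succ]
    simp only [Fin.init_snoc, Fin.snoc_last]
    push_cast
    ring
  · intro ℓ
    simp only [Fin.snoc_castSucc]

theorem exists_extend {i k : ℕ} (hi : 1 ≤ i) (hk : Even k) {δ : Fin (k + 1) → ℝ}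
    (hδ : δ ∈ digitSet i k) (n : ℕ) :
    ∃ δ' ∈ digitSet i (k + 2 * n), digitVal i (k + 2 * n) δ' = digitVal i k δ ∧
      ∀ ℓ : Fin (k + 1), δ' (Fin.castLE (by omega) ℓ) = δ ℓ := by
  induction n with
  | zero => exact ⟨δ, hδ, rfl, fun _ => rfl⟩
  | succ n ih =>
    obtain ⟨δ', h1, h2, h3⟩ := ih
    obtain ⟨δ'', h1', h2', h3'⟩ := exists_extend_add_two hi (hk.add (even_two_mul n)) h1
    exact ⟨δ'', h1', h2'.trans h2, fun ℓ => (h3' (Fin.castLE (by omega) ℓ)).trans (h3 ℓ)⟩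

theorem leftEnd_bounds {i : ℕ} (hi : 1 ≤ i) (n : ℕ) :
    leftEnd i (2 * n) ≤ -n ∧ (n : ℝ) ≤ leftEnd i (2 * n) + 2 ^ ((2 * n + 1) * i) := by
  induction n with
  | zero =>
    obtain ⟨j, rfl⟩ := Nat.exists_eq_add_of_le' hi
    have hj : (0 : ℝ) < 2 ^ j := by positivity
    simp only [leftEnd, mul_zero, zero_add, one_mul, Nat.add_sub_cancel, pow_succ]
    constructor
    · push_cast
      linarith
    · push_cast
      linarith
  | succ n ih =>
    obtain ⟨ih1, ih2⟩ := ih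
    have h1 : Odd (2 * n + 1) := odd_two_mul_add_one n
    have h2 : ¬ Odd (2 * n + 1 + 1) := Nat.not_odd_iff_even.2 h1.add_one
    have hL : leftEnd i (2 * (n + 1)) =
        leftEnd i (2 * n) - 2 ^ i * 2 ^ ((2 * n + 1) * i) := by
      rw [show 2 * (n + 1) = 2 * n + 1 + 1 by ring, leftEnd, leftEnd]
      simp only [minDigit, h1, h2, if_true, if_false]
      push_cast
      ring
    have hW : (2 : ℝ) ^ ((2 * (n + 1) + 1) * i) =
        2 ^ i * (2 ^ i * 2 ^ ((2 * n + 1) * i)) := by ring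
    rw [hL, hW]
    have hB : (2 : ℝ) ≤ 2 ^ i := le_self_pow₀ (by norm_num) (by omega)
    have hA : (1 : ℝ) ≤ 2 ^ ((2 * n + 1) * i) := one_le_pow₀ (by norm_num)
    generalize (2 : ℝ) ^ ((2 * n + 1) * i) = A at *
    generalize (2 : ℝ) ^ i = B at *
    have hBA : 2 * A ≤ B * A := mul_le_mul_of_nonneg_right hB (by linarith)
    have hBBA : 2 * (B * A) ≤ B * (B * A) := mul_le_mul_of_nonneg_right hB (by linarith)
    push_cast
    constructor <;> linarith

/-- (a) for every even `k` the evaluation map is injective on `digitSet i k` and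
its image is a half-open interval `(L, L + 2^{(k+1)i}]`; (b) every real number is represented
for all sufficiently large even `k`; (c) the representations for even `k ≤ k'` are compatible
in coordinates `0, …, k`. -/
theorem digit_representation (i : ℕ) (hi : 1 ≤ i) :
    (∀ k : ℕ, Even k →
      Set.InjOn (digitVal i k) (digitSet i k) ∧
      ∃ L : ℝ, digitVal i k '' digitSet i k = Set.Ioc L (L + 2 ^ ((k + 1) * i))) ∧
    (∀ lam : ℝ, ∃ k₀ : ℕ, Even k₀ ∧ ∀ k : ℕ, Even k → k₀ ≤ k →
      lam ∈ digitVal i k '' digitSet i k) ∧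
    (∀ k k' : ℕ, Even k → Even k' → ∀ h : k ≤ k',
      ∀ δ ∈ digitSet i k, ∀ δ' ∈ digitSet i k',
        digitVal i k δ = digitVal i k' δ' →
        ∀ ℓ : Fin (k + 1), δ ℓ = δ' (Fin.castLE (Nat.succ_le_succ h) ℓ)) := by
  refine ⟨fun k _ => ⟨injOn_digitVal hi k, _, image_digitVal hi k⟩, fun lam => ?_, ?_⟩
  · obtain ⟨n, hn⟩ := exists_nat_gt |lam|
    obtain ⟨hn1, hn2⟩ := abs_lt.1 hn
    refine ⟨2 * n, even_two_mul n, fun k hk hnk => ?_⟩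
    obtain ⟨m, rfl⟩ := hk.two_dvd
    have hnm : (n : ℝ) ≤ m := by exact_mod_cast (by omega : n ≤ m)
    obtain ⟨h1, h2⟩ := leftEnd_bounds hi m
    rw [image_digitVal hi]
    constructor <;> linarith
  · intro k k' hk hk' h δ hδ δ' hδ' heq ℓ
    obtain ⟨n, hn⟩ := (Nat.even_sub h).2 (iff_of_true hk' hk) |>.two_dvd
    obtain rfl : k' = k + 2 * n := by omega
    obtain ⟨δ'', h1, h2, h3⟩ := exists_extend hi hk hδ n
    rw [← injOn_digitVal hi _ h1 hδ' (h2.trans heq)]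
    exact (h3 ℓ).symm
end
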